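/- arXiv:1708.04660 — 7 statements merged into one kernel-verified Lean document; each statement's English description precedes it below -/
import Mathlib

section
/- Let n ≥ 5. There exists T₀ > 0 such that for every T ≥ T₀, equation (∗) admits a positive, nonconstant, 2T-periodic solution v ∈ C⁴(ℝ); moreover this solution satisfies 0 < v(t) ≤ L for all t ∈ ℝ, where L = (n³(n-4)/16)^{(n-4)/8}. -/
open Real Function intervalIntegral

/-- For `c ≠ 0` and `f` continuous and `P`-periodic, the `P`-periodic solution `u` of
`u' + c u = f`. -/
noncomputable def periodicResolvent (P c : ℝ) (f : ℝ → ℝ) (t : ℝ) : ℝ :=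
  (∫ s in (0:ℝ)..P, exp (c * s) * f (t + s)) / (exp (c * P) - 1)

lemma exp_mul_sub_one_ne_zero {P c : ℝ} (hP : 0 < P) (hc : c ≠ 0) : exp (c * P) - 1 ≠ 0 := by
  rw [sub_ne_zero, Ne, exp_eq_one_iff]
  exact mul_ne_zero hc hP.ne'

lemma exp_mul_sub_one_pos {P c : ℝ} (hP : 0 < P) (hc : 0 < c) : 0 < exp (c * P) - 1 :=
  sub_pos.2 (one_lt_exp_iff.2 (mul_pos hc hP))

namespace periodicResolvent

variable {P c d : ℝ} {f g : ℝ → ℝ}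

lemma periodic (hp : Periodic f P) : Periodic (periodicResolvent P c f) P := by
  intro t
  simp only [periodicResolvent]
  congr 2
  ext s
  rw [add_right_comm, hp]

lemma eq_exp_mul (P c : ℝ) (f : ℝ → ℝ) (t : ℝ) :
    periodicResolvent P c f t
      = exp (-(c * t)) * (∫ s in t..t + P, exp (c * s) * f s) / (exp (c * P) - 1) := by
  have h := integral_comp_add_left (a := 0) (b := P)
    (fun s => exp (-(c * t)) * (exp (c * s) * f s)) t
  rw [add_zero, integral_const_mul _ fun s => exp (c * s) * f s] at h
  rw [periodicResolvent, ← h]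
  congr 2
  ext s
  rw [← mul_assoc, ← exp_add]
  ring_nf

lemma hasDerivAt (hP : 0 < P) (hc : c ≠ 0) (hf : Continuous f) (hp : Periodic f P) (t : ℝ) :
    HasDerivAt (periodicResolvent P c f) (f t - c * periodicResolvent P c f t) t := by
  have hE := exp_mul_sub_one_ne_zero hP hc
  have hcont : Continuous fun s => exp (c * s) * f s := by fun_prop
  have hF : ∀ x, HasDerivAt (fun x => ∫ s in (0:ℝ)..x, exp (c * s) * f s) (exp (c * x) * f x) x :=
    fun x => integral_hasDerivAt_right (hcont.intervalIntegrable _ _)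
      (hcont.stronglyMeasurableAtFilter _ _) hcont.continuousAt
  have hQ : HasDerivAt (fun x => ∫ s in x..x + P, exp (c * s) * f s)
      (exp (c * (t + P)) * f (t + P) - exp (c * t) * f t) t := by
    have h1 := ((hF (t + P)).comp_add_const t P).sub (hF t)
    refine h1.congr_of_eventuallyEq (Filter.Eventually.of_forall fun x => ?_)
    simp only [Pi.sub_apply]
    rw [integral_interval_sub_left] <;> exact hcont.intervalIntegrable _ _
  have hexp : HasDerivAt (fun x => exp (-(c * x))) (exp (-(c * t)) * (-c)) t := by
    have := ((hasDerivAt_id t).const_mul c).neg.exp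
    simpa using this
  have h2 := (hexp.mul hQ).div_const (exp (c * P) - 1)
  have h3 : periodicResolvent P c f = fun t =>
      exp (-(c * t)) * (∫ s in t..t + P, exp (c * s) * f s) / (exp (c * P) - 1) :=
    funext (eq_exp_mul P c f)
  rw [eq_exp_mul P c f t, h3]
  refine h2.congr_deriv ?_
  have e1 : exp (-(c * t)) * exp (c * t) = 1 := by rw [← exp_add]; simp
  rw [hp t, mul_add, exp_add]
  field_simp
  linear_combination (f t * (exp (c * P) - 1)) * e1

lemma continuous (hP : 0 < P) (hc : c ≠ 0) (hf : Continuous f) (hp : Periodic f P) :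
    Continuous (periodicResolvent P c f) :=
  continuous_iff_continuousAt.2 fun t => (hasDerivAt hP hc hf hp t).continuousAt

/-- The periodic solution of `u' + c u = f` is unique. -/
lemma eq_of_hasDerivAt (hP : 0 < P) (hc : c ≠ 0) (hf : Continuous f) {u : ℝ → ℝ}
    (hu : ∀ t, HasDerivAt u (f t - c * u t) t) (hup : Periodic u P) :
    u = periodicResolvent P c f := by
  have hE := exp_mul_sub_one_ne_zero hP hc
  ext t
  have hcont : Continuous fun s => exp (c * s) * f s := by fun_prop
  have h1 : ∀ s, HasDerivAt (fun s => exp (c * s) * u s) (exp (c * s) * f s) s := by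
    intro s
    have hexp : HasDerivAt (fun x => exp (c * x)) (exp (c * s) * c) s := by
      simpa using ((hasDerivAt_id s).const_mul c).exp
    refine (hexp.mul (hu s)).congr_deriv ?_
    ring
  have h2 := integral_eq_sub_of_hasDerivAt (a := t) (b := t + P) (fun s _ => h1 s)
    (hcont.intervalIntegrable _ _)
  rw [eq_exp_mul, h2, hup t]
  have e1 : exp (-(c * t)) * exp (c * t) = 1 := by rw [← exp_add]; simp
  rw [mul_add, exp_add]
  field_simp
  linear_combination (-u t) * e1

lemma comm (hP : 0 < P) (hc : c ≠ 0) (hd : d ≠ 0) (hf : Continuous f) (hp : Periodic f P) :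
    periodicResolvent P c (periodicResolvent P d f)
      = periodicResolvent P d (periodicResolvent P c f) := by
  set u := periodicResolvent P c f with hu
  have hup : Periodic u P := periodic hp
  have huc : Continuous u := continuous hP hc hf hp
  set w := periodicResolvent P d u with hw
  have hw' := hasDerivAt hP hd huc hup
  have hu' := hasDerivAt hP hc hf hp
  have hwp : Periodic w P := periodic hup
  have key : (fun t => u t + (c - d) * w t) = periodicResolvent P d f := by
    refine eq_of_hasDerivAt hP hd hf (fun t => ?_) fun t => by simp only [hup t, hwp t]
    refine ((hu' t).add ((hw' t).const_mul (c - d))).congr_deriv ?_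
    ring
  rw [← key]
  refine (eq_of_hasDerivAt hP hc (by have := continuous hP hd huc hup; fun_prop)
    (fun t => (hw' t).congr_deriv ?_) hwp).symm
  ring

/-- The formal adjoint of `periodicResolvent P c` is `-periodicResolvent P (-c)`. -/
lemma integral_mul (hP : 0 < P) (hc : c ≠ 0) (hf : Continuous f) (hp : Periodic f P)
    (hg : Continuous g) (hgp : Periodic g P) :
    ∫ t in (0:ℝ)..P, periodicResolvent P c f t * g t
      = -∫ t in (0:ℝ)..P, f t * periodicResolvent P (-c) g t := by
  set u := periodicResolvent P c f
  set w := periodicResolvent P (-c) g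
  have hc' : -c ≠ 0 := neg_ne_zero.2 hc
  have huc : Continuous u := continuous hP hc hf hp
  have hwc : Continuous w := continuous hP hc' hg hgp
  have h1 : ∀ t, HasDerivAt (fun t => u t * w t) (u t * g t + f t * w t) t := by
    intro t
    refine ((hasDerivAt hP hc hf hp t).mul (hasDerivAt hP hc' hg hgp t)).congr_deriv ?_
    ring
  have h2 := integral_eq_sub_of_hasDerivAt (a := 0) (b := P) (fun s _ => h1 s)
    ((by fun_prop : Continuous _).intervalIntegrable _ _)
  have e1 : u P = u 0 := (periodic hp : Periodic u P).eq
  have e2 : w P = w 0 := (periodic hgp : Periodic w P).eq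
  rw [e1, e2, sub_self, integral_add (f := fun t => u t * g t) (g := fun t => f t * w t)
    ((huc.mul hg).intervalIntegrable _ _) ((hf.mul hwc).intervalIntegrable _ _)] at h2
  linarith

lemma sub (hf : Continuous f) (hg : Continuous g) :
    periodicResolvent P c (fun t => f t - g t)
      = fun t => periodicResolvent P c f t - periodicResolvent P c g t := by
  ext t
  simp only [periodicResolvent, mul_sub]
  rw [integral_sub ((by fun_prop : Continuous _).intervalIntegrable _ _)
    ((by fun_prop : Continuous _).intervalIntegrable _ _), sub_div]

lemma nonneg (hP : 0 < P) (hc : 0 < c) (hf : ∀ t, 0 ≤ f t) (t : ℝ) :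
    0 ≤ periodicResolvent P c f t :=
  div_nonneg (integral_nonneg hP.le fun _ _ => mul_nonneg (exp_pos _).le (hf _))
    (exp_mul_sub_one_pos hP hc).le

lemma neg_nonneg (hP : 0 < P) (hc : 0 < c) (hf : ∀ t, 0 ≤ f t) (t : ℝ) :
    0 ≤ -periodicResolvent P (-c) f t := by
  have : exp (-c * P) - 1 ≤ 0 := by
    rw [sub_nonpos, exp_le_one_iff]; nlinarith
  rw [Left.nonneg_neg_iff]
  exact div_nonpos_of_nonneg_of_nonpos
    (integral_nonneg hP.le fun _ _ => mul_nonneg (exp_pos _).le (hf _)) this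

lemma neg (P c : ℝ) (f : ℝ → ℝ) : periodicResolvent P c (-f) = -periodicResolvent P c f := by
  ext t
  simp only [periodicResolvent, Pi.neg_apply, mul_neg, integral_neg, neg_div]

lemma eq_zero_imp (hP : 0 < P) (hc : c ≠ 0) (hf : Continuous f) (hp : Periodic f P)
    (h : ∀ t, periodicResolvent P c f t = 0) (t : ℝ) : f t = 0 := by
  have h1 := hasDerivAt hP hc hf hp t
  have h2 : periodicResolvent P c f = fun _ => 0 := funext h
  rw [h2] at h1
  simpa using h1.unique (hasDerivAt_const t (0:ℝ))

/-- A quantitative lower bound coming from the values of `f` on `[t - d, t]`. -/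
lemma le_of_le_on (hP : 0 < P) (hc : 0 < c) (hf : Continuous f) (hp : Periodic f P)
    (hf0 : ∀ t, 0 ≤ f t) {m t : ℝ} (hd : 0 ≤ d) (hm0 : 0 ≤ m)
    (hm : ∀ s, t - d ≤ s → s ≤ t → m ≤ f s) :
    d * exp (-(c * d)) * m ≤ periodicResolvent P c f t := by
  set u := periodicResolvent P c f
  have h1 : ∀ s, HasDerivAt (fun s => exp (c * s) * u s) (exp (c * s) * f s) s := by
    intro s
    have hexp : HasDerivAt (fun x => exp (c * x)) (exp (c * s) * c) s := by
      simpa using ((hasDerivAt_id s).const_mul c).exp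
    refine (hexp.mul (hasDerivAt hP hc.ne' hf hp s)).congr_deriv ?_
    ring
  have hcont : Continuous fun s => exp (c * s) * f s := by fun_prop
  have h2 := integral_eq_sub_of_hasDerivAt (a := t - d) (b := t) (fun s _ => h1 s)
    (hcont.intervalIntegrable _ _)
  have h3 : ∫ _ in (t - d)..t, exp (c * (t - d)) * m ≤ ∫ s in (t - d)..t, exp (c * s) * f s := by
    refine integral_mono_on (by linarith) (by simp) (hcont.intervalIntegrable _ _) fun s hs => ?_
    refine mul_le_mul (exp_le_exp.2 ?_) (hm s hs.1 hs.2) hm0 (exp_pos _).le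
    exact mul_le_mul_of_nonneg_left hs.1 hc.le
  rw [integral_const, smul_eq_mul, h2] at h3
  have h4 : 0 ≤ exp (c * (t - d)) * u (t - d) := mul_nonneg (exp_pos _).le (nonneg hP hc hf0 _)
  have h5 : exp (c * (t - d)) = exp (c * t) * exp (-(c * d)) := by rw [← exp_add]; ring_nf
  have h6 : exp (c * t) * (d * exp (-(c * d)) * m) ≤ exp (c * t) * u t := by
    rw [h5] at h3 h4
    linarith
  exact le_of_mul_le_mul_left h6 (exp_pos _)

/-- `periodicResolvent P c` is bounded from `L¹` of a period to `L^∞`. -/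
lemma abs_le (hP : 0 < P) (hf : Continuous f) (hp : Periodic f P) (t : ℝ) :
    |periodicResolvent P c f t|
      ≤ exp (|c| * P) / |exp (c * P) - 1| * ∫ s in (0:ℝ)..P, |f s| := by
  rw [periodicResolvent, abs_div, div_mul_eq_mul_div]
  refine div_le_div_of_nonneg_right ?_ (abs_nonneg _)
  refine (abs_integral_le_integral_abs hP.le).trans ?_
  have hpa : Periodic (fun s => |f s|) P := fun s => by simp only [hp s]
  have h1 : ∫ s in (0:ℝ)..P, |f s| = ∫ s in (0:ℝ)..P, |f (t + s)| := by
    rw [integral_comp_add_left (fun s => |f s|) t, add_zero]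
    simpa using hpa.intervalIntegral_add_eq 0 t
  rw [h1, ← integral_const_mul]
  refine integral_mono_on hP.le ((by fun_prop : Continuous _).intervalIntegrable _ _)
    ((by fun_prop : Continuous _).intervalIntegrable _ _) fun s hs => ?_
  rw [abs_mul, abs_of_pos (exp_pos _)]
  refine mul_le_mul_of_nonneg_right (exp_le_exp.2 ?_) (abs_nonneg _)
  calc c * s ≤ |c| * s := mul_le_mul_of_nonneg_right (le_abs_self c) hs.1
    _ ≤ |c| * P := mul_le_mul_of_nonneg_left hs.2 (abs_nonneg c)

lemma abs_le_of_abs_le (hP : 0 < P) (hf : Continuous f) (hp : Periodic f P) {M : ℝ}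
    (hM : ∀ t, |f t| ≤ M) (t : ℝ) :
    |periodicResolvent P c f t| ≤ exp (|c| * P) / |exp (c * P) - 1| * (P * M) := by
  refine (abs_le hP hf hp t).trans (mul_le_mul_of_nonneg_left ?_ (by positivity))
  calc ∫ s in (0:ℝ)..P, |f s| ≤ ∫ _ in (0:ℝ)..P, M :=
        integral_mono_on hP.le (hf.abs.intervalIntegrable _ _) (by simp) fun s _ => hM s
    _ = P * M := by simp

lemma continuous_uncurry {X : Type*} [TopologicalSpace X] {F : X → ℝ → ℝ}
    (hF : Continuous fun x : X × ℝ => F x.1 x.2) :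
    Continuous fun x : X × ℝ => periodicResolvent P c (F x.1) x.2 := by
  unfold periodicResolvent
  refine Continuous.div_const (continuous_parametric_intervalIntegral_of_continuous'
    (f := fun (x : X × ℝ) s => exp (c * s) * F x.1 (x.2 + s)) ?_ 0 P) _
  have : Continuous fun y : (X × ℝ) × ℝ => F y.1.1 (y.1.2 + y.2) :=
    hF.comp (by fun_prop : Continuous fun y : (X × ℝ) × ℝ => (y.1.1, y.1.2 + y.2))
  exact ((by fun_prop : Continuous fun y : (X × ℝ) × ℝ => exp (c * y.2))).mul this

end periodicResolvent

namespace periodicResolvent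

variable {P c : ℝ} {f : ℝ → ℝ}

lemma mul_pos_of_nonneg (hP : 0 < P) (hc : c ≠ 0) (hf : Continuous f) (hp : Periodic f P)
    (hf0 : ∀ t, 0 ≤ f t) (hne : ∃ t, 0 < f t) (t : ℝ) :
    0 < (exp (c * P) - 1) * periodicResolvent P c f t := by
  rw [periodicResolvent, mul_div_cancel₀ _ (exp_mul_sub_one_ne_zero hP hc)]
  obtain ⟨r, hr⟩ := hne
  have hp' : Periodic (fun s => f (t + s)) P := fun s => by
    simp only [← add_assoc]; exact hp _
  obtain ⟨s, hs, hse⟩ := hp'.exists_mem_Ico₀ hP (r - t)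
  refine integral_pos hP (by fun_prop) (fun s _ => mul_nonneg (exp_pos _).le (hf0 _))
    ⟨s, ⟨hs.1, hs.2.le⟩, mul_pos (exp_pos _) ?_⟩
  rw [← hse]
  simpa using hr

lemma pos (hP : 0 < P) (hc : 0 < c) (hf : Continuous f) (hp : Periodic f P)
    (hf0 : ∀ t, 0 ≤ f t) (hne : ∃ t, 0 < f t) (t : ℝ) : 0 < periodicResolvent P c f t :=
  pos_of_mul_pos_right (mul_pos_of_nonneg hP hc.ne' hf hp hf0 hne t) (exp_mul_sub_one_pos hP hc).le

lemma neg_pos (hP : 0 < P) (hc : 0 < c) (hf : Continuous f) (hp : Periodic f P)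
    (hf0 : ∀ t, 0 ≤ f t) (hne : ∃ t, 0 < f t) (t : ℝ) : 0 < -periodicResolvent P (-c) f t := by
  have h1 := mul_pos_of_nonneg hP (neg_ne_zero.2 hc.ne') hf hp hf0 hne t
  have h2 : exp (-c * P) - 1 < 0 := by
    rw [sub_neg, exp_lt_one_iff]; nlinarith
  nlinarith

end periodicResolvent

/-- The inverse of `(D² - a²)(D² - b²)` on `P`-periodic functions. -/
noncomputable def periodicGreen (P a b : ℝ) (f : ℝ → ℝ) : ℝ → ℝ :=
  periodicResolvent P (-b) (periodicResolvent P b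
    (periodicResolvent P (-a) (periodicResolvent P a f)))

/-- The inverse of `(D + a)(D + b)` on `P`-periodic functions. -/
noncomputable def halfGreen (P a b : ℝ) (f : ℝ → ℝ) : ℝ → ℝ :=
  periodicResolvent P b (periodicResolvent P a f)

section Green

variable {P a b : ℝ} {f g : ℝ → ℝ}

lemma halfGreen_continuous (hP : 0 < P) (ha : 0 < a) (hb : 0 < b) (hf : Continuous f)
    (hp : Periodic f P) : Continuous (halfGreen P a b f) :=
  periodicResolvent.continuous hP hb.ne' (periodicResolvent.continuous hP ha.ne' hf hp)
    (periodicResolvent.periodic hp)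

lemma halfGreen_periodic (hp : Periodic f P) : Periodic (halfGreen P a b f) P :=
  periodicResolvent.periodic (periodicResolvent.periodic hp)

lemma periodicGreen_periodic (hp : Periodic f P) : Periodic (periodicGreen P a b f) P :=
  halfGreen_periodic (halfGreen_periodic hp)

lemma halfGreen_sub (hP : 0 < P) (ha : 0 < a) (hf : Continuous f) (hp : Periodic f P)
    (hg : Continuous g) (hgp : Periodic g P) :
    halfGreen P a b (fun t => f t - g t) = fun t => halfGreen P a b f t - halfGreen P a b g t := by
  rw [halfGreen, periodicResolvent.sub hf hg, periodicResolvent.sub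
    (periodicResolvent.continuous hP ha.ne' hf hp) (periodicResolvent.continuous hP ha.ne' hg hgp)]
  rfl

lemma halfGreen_eq_zero_imp (hP : 0 < P) (ha : 0 < a) (hb : 0 < b) (hf : Continuous f)
    (hp : Periodic f P) (h : ∀ t, halfGreen P a b f t = 0) (t : ℝ) : f t = 0 :=
  periodicResolvent.eq_zero_imp hP ha.ne' hf hp (periodicResolvent.eq_zero_imp hP hb.ne'
    (periodicResolvent.continuous hP ha.ne' hf hp) (periodicResolvent.periodic hp) h) t

lemma integral_mul_periodicGreen (hP : 0 < P) (ha : 0 < a) (hb : 0 < b)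
    (hf : Continuous f) (hp : Periodic f P) (hg : Continuous g) (hgp : Periodic g P) :
    ∫ t in (0:ℝ)..P, f t * periodicGreen P a b g t
      = ∫ t in (0:ℝ)..P, halfGreen P a b f t * halfGreen P a b g t := by
  have ha' : -a ≠ 0 := neg_ne_zero.2 ha.ne'
  set h := periodicResolvent P a g with hh
  have hhc : Continuous h := periodicResolvent.continuous hP ha.ne' hg hgp
  have hhp : Periodic h P := periodicResolvent.periodic hgp
  have hkc : Continuous (periodicResolvent P b h) :=
    periodicResolvent.continuous hP hb.ne' hhc hhp
  have hkp : Periodic (periodicResolvent P b h) P := periodicResolvent.periodic hhp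
  have e1 := periodicResolvent.integral_mul hP hb.ne' hf hp
    (periodicResolvent.continuous hP ha' hkc hkp)
    (periodicResolvent.periodic (c := -a) hkp)
  have e2 := periodicResolvent.integral_mul hP ha.ne'
    (periodicResolvent.continuous hP hb.ne' hf hp)
    (periodicResolvent.periodic (c := b) hp) hkc hkp
  rw [periodicGreen, halfGreen, halfGreen, periodicResolvent.comm hP hb.ne' ha' hhc hhp,
    periodicResolvent.comm hP hb.ne' ha.ne' hf hp, e2, e1, neg_neg]

lemma periodicGreen_pos (hP : 0 < P) (ha : 0 < a) (hb : 0 < b) (hf : Continuous f)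
    (hp : Periodic f P) (hf0 : ∀ t, 0 ≤ f t) (hne : ∃ t, 0 < f t) (t : ℝ) :
    0 < periodicGreen P a b f t := by
  have c1 := periodicResolvent.continuous hP ha.ne' hf hp
  have q1 := periodicResolvent.periodic (c := a) hp
  have r1 := periodicResolvent.pos hP ha hf hp hf0 hne
  have c2 := periodicResolvent.continuous hP (neg_ne_zero.2 ha.ne') c1 q1
  have q2 := periodicResolvent.periodic (c := -a) q1
  have r2 := periodicResolvent.neg_pos hP ha c1 q1 (fun t => (r1 t).le) ⟨0, r1 0⟩
  have q2' : Periodic (fun t => -periodicResolvent P (-a) (periodicResolvent P a f) t) P :=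
    fun t => by simp only [q2 t]
  have c3 := periodicResolvent.continuous hP hb.ne' c2.neg q2'
  have q3 := periodicResolvent.periodic (c := b) q2'
  have r3 := periodicResolvent.pos hP hb c2.neg q2' (fun t => (r2 t).le) ⟨0, r2 0⟩
  have r4 := periodicResolvent.neg_pos hP hb c3 q3 (fun t => (r3 t).le) ⟨0, r3 0⟩ t
  rw [periodicResolvent.neg, periodicResolvent.neg, Pi.neg_apply, neg_neg] at r4
  exact r4

/-- The derivatives up to order four of `periodicGreen P a b f`. -/
lemma periodicGreen_derivs (hP : 0 < P) (ha : 0 < a) (hb : 0 < b) (hf : Continuous f)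
    (hp : Periodic f P) : ∃ d₁ d₂ d₃ : ℝ → ℝ,
      (∀ t, d₁ t = periodicResolvent P b (halfGreen P a (-a) f) t + b * periodicGreen P a b f t) ∧
      (∀ t, d₂ t = halfGreen P a (-a) f t + b ^ 2 * periodicGreen P a b f t) ∧
      (∀ t, HasDerivAt (periodicGreen P a b f) (d₁ t) t) ∧
      (∀ t, HasDerivAt d₁ (d₂ t) t) ∧ (∀ t, HasDerivAt d₂ (d₃ t) t) ∧
      (∀ t, HasDerivAt d₃
        (f t + (a ^ 2 + b ^ 2) * d₂ t - a ^ 2 * b ^ 2 * periodicGreen P a b f t) t) := by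
  have ha' : -a ≠ 0 := neg_ne_zero.2 ha.ne'
  have hb' : -b ≠ 0 := neg_ne_zero.2 hb.ne'
  set y₁ := periodicResolvent P a f with hy₁
  have c1 : Continuous y₁ := periodicResolvent.continuous hP ha.ne' hf hp
  have q1 : Periodic y₁ P := periodicResolvent.periodic (c := a) hp
  have D1 : ∀ t, HasDerivAt y₁ _ t := periodicResolvent.hasDerivAt hP ha.ne' hf hp
  set y := periodicResolvent P (-a) y₁ with hy
  have c2 : Continuous y := periodicResolvent.continuous hP ha' c1 q1
  have q2 : Periodic y P := periodicResolvent.periodic q1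
  have D2 : ∀ t, HasDerivAt y _ t := periodicResolvent.hasDerivAt hP ha' c1 q1
  set w := periodicResolvent P b y with hw
  have c3 : Continuous w := periodicResolvent.continuous hP hb.ne' c2 q2
  have q3 : Periodic w P := periodicResolvent.periodic q2
  have D3 : ∀ t, HasDerivAt w _ t := periodicResolvent.hasDerivAt hP hb.ne' c2 q2
  have D4 := periodicResolvent.hasDerivAt hP hb' c3 q3
  have hu : periodicGreen P a b f = periodicResolvent P (-b) w := rfl
  have hh : halfGreen P a (-a) f = y := rfl
  rw [hu, hh]
  set u := periodicResolvent P (-b) w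
  have E1 : ∀ t, HasDerivAt u (w t + b * u t) t := fun t => (D4 t).congr_deriv (by ring)
  have E2 : ∀ t, HasDerivAt (fun t => w t + b * u t) (y t + b ^ 2 * u t) t := fun t =>
    ((D3 t).add ((E1 t).const_mul b)).congr_deriv (by ring)
  refine ⟨fun t => w t + b * u t, fun t => y t + b ^ 2 * u t,
    fun t => y₁ t + a * y t + b ^ 2 * (w t + b * u t), fun _ => rfl, fun _ => rfl, E1, E2,
    fun t => ?_, fun t => ?_⟩
  · exact ((D2 t).add ((E1 t).const_mul (b ^ 2))).congr_deriv (by simp only [← hy]; ring)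
  · exact (((D1 t).add ((D2 t).const_mul a)).add ((E2 t).const_mul (b ^ 2))).congr_deriv
      (by simp only [← hy₁, ← hy]; ring)

lemma halfGreen_neg_nonpos (hP : 0 < P) (ha : 0 < a) (hf0 : ∀ t, 0 ≤ f t) (t : ℝ) :
    halfGreen P a (-a) f t ≤ 0 :=
  neg_nonneg.1 (periodicResolvent.neg_nonneg hP ha (periodicResolvent.nonneg hP ha hf0) t)

/-- Bounds for `periodicGreen P a b f` and its derivative in terms of the `L¹` norm of `f`. -/
lemma periodicGreen_bound (hP : 0 < P) (ha : 0 < a) (hb : 0 < b) : ∃ D : ℝ, 0 ≤ D ∧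
    ∀ f : ℝ → ℝ, Continuous f → Periodic f P → ∀ t,
      |periodicGreen P a b f t| ≤ D * ∫ s in (0:ℝ)..P, |f s| ∧
      |periodicResolvent P b (halfGreen P a (-a) f) t + b * periodicGreen P a b f t|
        ≤ D * ∫ s in (0:ℝ)..P, |f s| := by
  have ha' : -a ≠ 0 := neg_ne_zero.2 ha.ne'
  have hb' : -b ≠ 0 := neg_ne_zero.2 hb.ne'
  set E : ℝ → ℝ := fun c => exp (|c| * P) / |exp (c * P) - 1| with hE
  have hE0 : ∀ c, 0 ≤ E c := fun c => by positivity
  set D₃ := E b * (P * (E (-a) * (P * E a))) with hD₃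
  set D₄ := E (-b) * (P * D₃) with hD₄
  have h3 : 0 ≤ D₃ :=
    mul_nonneg (hE0 _) (mul_nonneg hP.le (mul_nonneg (hE0 _) (mul_nonneg hP.le (hE0 _))))
  have h4 : 0 ≤ D₄ := mul_nonneg (hE0 _) (mul_nonneg hP.le h3)
  refine ⟨D₃ + D₄ + b * D₄, by positivity, fun f hf hp t => ?_⟩
  set S := ∫ s in (0:ℝ)..P, |f s| with hS
  have hS0 : 0 ≤ S := integral_nonneg hP.le fun _ _ => abs_nonneg _
  have c1 := periodicResolvent.continuous hP ha.ne' hf hp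
  have q1 := periodicResolvent.periodic (c := a) hp
  have r1 : ∀ t, |periodicResolvent P a f t| ≤ E a * S := periodicResolvent.abs_le hP hf hp
  have c2 := periodicResolvent.continuous hP ha' c1 q1
  have q2 := periodicResolvent.periodic (c := -a) q1
  have r2 := periodicResolvent.abs_le_of_abs_le (c := -a) hP c1 q1 r1
  have c3 := periodicResolvent.continuous hP hb.ne' c2 q2
  have q3 := periodicResolvent.periodic (c := b) q2
  have r3 := periodicResolvent.abs_le_of_abs_le (c := b) hP c2 q2 r2
  have r4 := periodicResolvent.abs_le_of_abs_le (c := -b) hP c3 q3 r3 t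
  have r3 := r3 t
  change |periodicGreen P a b f t| ≤ E (-b) * (P * (E b * (P * (E (-a) * (P * (E a * S)))))) at r4
  change |periodicResolvent P b (halfGreen P a (-a) f) t|
    ≤ E b * (P * (E (-a) * (P * (E a * S)))) at r3
  have r4' : |periodicGreen P a b f t| ≤ D₄ * S := r4.trans_eq (by rw [hD₄, hD₃]; ring)
  have r3' : |periodicResolvent P b (halfGreen P a (-a) f) t| ≤ D₃ * S :=
    r3.trans_eq (by rw [hD₃]; ring)
  have k1 := mul_nonneg h3 hS0
  have k2 := mul_nonneg h4 hS0
  have k3 := mul_nonneg hb.le k2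
  constructor
  · linarith
  · refine (abs_add_le _ _).trans ?_
    rw [abs_mul, abs_of_pos hb]
    have := mul_le_mul_of_nonneg_left r4' hb.le
    linarith

end Green

/-- The `C`-Lipschitz `P`-periodic functions with values in `[0, M]`. -/
def lipschitzPeriodic (P M C : ℝ) : Set (ℝ → ℝ) :=
  {f | Periodic f P ∧ (∀ t, 0 ≤ f t ∧ f t ≤ M) ∧ ∀ s t, |f s - f t| ≤ C * |s - t|}

namespace lipschitzPeriodic

variable {P M C : ℝ}

lemma isCompact (P M C : ℝ) : IsCompact (lipschitzPeriodic P M C) := by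
  refine (isCompact_univ_pi fun _ : ℝ => isCompact_Icc (a := (0:ℝ)) (b := M)).of_isClosed_subset
    ?_ fun f hf t _ => hf.2.1 t
  simp only [lipschitzPeriodic, Periodic, Set.ofPred_and, Set.ofPred_forall]
  refine IsClosed.inter (isClosed_iInter fun t => isClosed_eq (by fun_prop) (by fun_prop))
    (IsClosed.inter (isClosed_iInter fun t => IsClosed.inter
      (isClosed_le (by fun_prop) (by fun_prop)) (isClosed_le (by fun_prop) (by fun_prop)))
      (isClosed_iInter fun s => isClosed_iInter fun t => isClosed_le ?_ continuous_const))
  exact ((continuous_apply s).sub (continuous_apply t)).abs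

lemma continuous {f : ℝ → ℝ} (hf : f ∈ lipschitzPeriodic P M C) : Continuous f := by
  refine (LipschitzWith.of_dist_le' (K := C) fun s t => ?_).continuous
  rw [Real.dist_eq, Real.dist_eq]
  exact hf.2.2 s t

lemma continuous_eval :
    Continuous fun x : lipschitzPeriodic P M C × ℝ => (x.1 : ℝ → ℝ) x.2 := by
  refine continuous_iff_continuousAt.2 fun ⟨f₀, t₀⟩ => ?_
  rw [ContinuousAt, tendsto_iff_dist_tendsto_zero]
  have h0 : Continuous fun x : lipschitzPeriodic P M C × ℝ =>
      C * |x.2 - t₀| + |(x.1 : ℝ → ℝ) t₀ - (f₀ : ℝ → ℝ) t₀| := by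
    have : Continuous fun x : lipschitzPeriodic P M C × ℝ => (x.1 : ℝ → ℝ) t₀ :=
      (continuous_apply t₀).comp (continuous_subtype_val.comp continuous_fst)
    fun_prop
  refine squeeze_zero (fun _ => dist_nonneg) (fun x => ?_)
    (by simpa using h0.tendsto (f₀, t₀))
  rw [Real.dist_eq]
  calc |(x.1 : ℝ → ℝ) x.2 - (f₀ : ℝ → ℝ) t₀|
      ≤ |(x.1 : ℝ → ℝ) x.2 - (x.1 : ℝ → ℝ) t₀| + |(x.1 : ℝ → ℝ) t₀ - (f₀ : ℝ → ℝ) t₀| :=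
        abs_sub_le _ _ _
    _ ≤ _ := by gcongr; exact x.1.2.2.2 _ _

lemma exists_maximizer {a b q : ℝ} (hq : 0 ≤ q) {f₀ : ℝ → ℝ} (hf₀ : f₀ ∈ lipschitzPeriodic P M C)
    (h₀ : ∫ t in (0:ℝ)..P, f₀ t ^ q ≤ 1) :
    ∃ f ∈ lipschitzPeriodic P M C, ∫ t in (0:ℝ)..P, f t ^ q ≤ 1 ∧
      ∀ g ∈ lipschitzPeriodic P M C, ∫ t in (0:ℝ)..P, g t ^ q ≤ 1 →
        ∫ t in (0:ℝ)..P, halfGreen P a b g t ^ 2 ≤ ∫ t in (0:ℝ)..P, halfGreen P a b f t ^ 2 := by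
  have := isCompact_iff_compactSpace.1 (isCompact P M C)
  have hJ : Continuous fun x : lipschitzPeriodic P M C =>
      ∫ t in (0:ℝ)..P, halfGreen P a b x t ^ 2 := by
    refine continuous_parametric_intervalIntegral_of_continuous'
      (f := fun (x : lipschitzPeriodic P M C) t => halfGreen P a b x t ^ 2) ?_ 0 P
    have h1 := periodicResolvent.continuous_uncurry (P := P) (c := a)
      (F := fun x : lipschitzPeriodic P M C => (x : ℝ → ℝ)) continuous_eval
    have h2 := periodicResolvent.continuous_uncurry (P := P) (c := b)
      (F := fun x : lipschitzPeriodic P M C => periodicResolvent P a x) h1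
    exact h2.pow 2
  have hN : Continuous fun x : lipschitzPeriodic P M C =>
      ∫ t in (0:ℝ)..P, (x : ℝ → ℝ) t ^ q :=
    continuous_parametric_intervalIntegral_of_continuous'
      (f := fun (x : lipschitzPeriodic P M C) t => (x : ℝ → ℝ) t ^ q)
      (continuous_eval.rpow_const fun _ => Or.inr hq) 0 P
  have hS : IsClosed {x : lipschitzPeriodic P M C | ∫ t in (0:ℝ)..P, (x : ℝ → ℝ) t ^ q ≤ 1} :=
    isClosed_le hN continuous_const
  obtain ⟨f, hf, hmax⟩ := hS.isCompact.exists_isMaxOn ⟨⟨f₀, hf₀⟩, h₀⟩ hJ.continuousOn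
  refine ⟨f, f.2, hf, fun g hg hg1 => ?_⟩
  exact isMaxOn_iff.1 hmax ⟨g, hg⟩ hg1

end lipschitzPeriodic

/-- A maximizer of the quadratic form `∫ f (periodicGreen f)` on the unit ball of `L^((p+1)/p)`
solves the Euler–Lagrange equation `f = (periodicGreen f / N) ^ p`. -/
lemma exists_normalized_solution {P a b p J₀ : ℝ} (hP : 0 < P) (ha : 0 < a) (hb : 0 < b)
    (hp : 1 < p) (hJ₀ : 0 < J₀) {f₀ : ℝ → ℝ} (hf₀ : f₀ ∈ lipschitzPeriodic P 1 1)
    (hf₀1 : ∫ t in (0:ℝ)..P, f₀ t ^ ((p + 1) / p) ≤ 1)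
    (hf₀J : J₀ ≤ ∫ t in (0:ℝ)..P, halfGreen P a b f₀ t ^ 2) :
    ∃ (f : ℝ → ℝ) (N : ℝ), Continuous f ∧ Periodic f P ∧ (∀ t, 0 ≤ f t) ∧ J₀ ≤ N ∧
      (∀ t, 0 < periodicGreen P a b f t) ∧ (∀ t, f t = (periodicGreen P a b f t / N) ^ p) ∧
      ∫ t in (0:ℝ)..P, (periodicGreen P a b f t / N) ^ (p + 1) = 1 := by
  obtain ⟨D, hD0, hD⟩ := periodicGreen_bound hP ha hb
  have hp0 : 0 < p := by linarith
  have hq : 1 < (p + 1) / p := by rw [one_lt_div hp0]; linarith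
  set q := (p + 1) / p with hq_def
  set W := D * (P + 1) / J₀ with hW
  have hW0 : 0 ≤ W := by positivity
  have sub1 : lipschitzPeriodic P 1 1
      ⊆ lipschitzPeriodic P (max 1 (W ^ p)) (max 1 (p * W ^ (p - 1) * W)) := fun f hf =>
    ⟨hf.1, fun t => ⟨(hf.2.1 t).1, (hf.2.1 t).2.trans (le_max_left _ _)⟩, fun s t =>
      (hf.2.2 s t).trans (mul_le_mul_of_nonneg_right (le_max_left _ _) (abs_nonneg _))⟩
  obtain ⟨f, hfK, hf1, hmax⟩ := lipschitzPeriodic.exists_maximizer (a := a) (b := b)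
    (by linarith : (0:ℝ) ≤ q) (sub1 hf₀) hf₀1
  have hfJ := hf₀J.trans (hmax f₀ (sub1 hf₀) hf₀1)
  have hfc := lipschitzPeriodic.continuous hfK
  have hfp := hfK.1
  have hf0 : ∀ t, 0 ≤ f t := fun t => (hfK.2.1 t).1
  set J : (ℝ → ℝ) → ℝ := fun f => ∫ t in (0:ℝ)..P, halfGreen P a b f t ^ 2 with hJ
  change J₀ ≤ J f at hfJ
  have hfqc : Continuous fun t => f t ^ q :=
    hfc.rpow_const fun _ => Or.inr (by linarith)
  obtain ⟨d₁, d₂, d₃, hd₁, -, hud, -⟩ := periodicGreen_derivs hP ha hb hfc hfp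
  have hbd := hD f hfc hfp
  have hpair := integral_mul_periodicGreen hP ha hb hfc hfp hfc hfp
  have hup : Periodic (periodicGreen P a b f) P := periodicGreen_periodic hfp
  have hupos := periodicGreen_pos hP ha hb hfc hfp hf0
  have hadj : ∀ g : ℝ → ℝ, Continuous g → Periodic g P →
      ∫ t in (0:ℝ)..P, g t * periodicGreen P a b f t
        = ∫ t in (0:ℝ)..P, halfGreen P a b g t * halfGreen P a b f t :=
    fun g hg hgp => integral_mul_periodicGreen hP ha hb hg hgp hfc hfp
  set u := periodicGreen P a b f with hu
  have huc : Continuous u := continuous_iff_continuousAt.2 fun t => (hud t).continuousAt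
  have hpair' : ∫ t in (0:ℝ)..P, f t * u t = J f := by
    rw [hpair]; simp only [hJ, sq]
  have hne : ∃ t, 0 < f t := by
    by_contra! h
    have : ∀ t, f t = 0 := fun t => le_antisymm (h t) (hf0 t)
    simp only [this, zero_mul, integral_zero] at hpair'
    linarith
  replace hupos := hupos hne
  have hupc : Continuous fun t => u t ^ (p + 1) :=
    huc.rpow_const fun _ => Or.inr (by linarith)
  have hI : 0 < ∫ t in (0:ℝ)..P, u t ^ (p + 1) :=
    integral_pos hP hupc.continuousOn (fun t _ => (rpow_pos_of_pos (hupos t) _).le)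
      ⟨0, ⟨le_rfl, hP.le⟩, rpow_pos_of_pos (hupos 0) _⟩
  set N := (∫ t in (0:ℝ)..P, u t ^ (p + 1)) ^ (p + 1)⁻¹ with hN
  have hN0 : 0 < N := rpow_pos_of_pos hI _
  have hNp : N ^ (p + 1) = ∫ t in (0:ℝ)..P, u t ^ (p + 1) :=
    rpow_inv_rpow hI.le (by linarith)
  have hw0 : ∀ t, 0 < u t / N := fun t => div_pos (hupos t) hN0
  have hwc : Continuous fun t => u t / N := huc.div_const _
  have hwpc : Continuous fun t => (u t / N) ^ (p + 1) :=
    hwc.rpow_const fun _ => Or.inr (by linarith)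
  have hw1 : ∫ t in (0:ℝ)..P, (u t / N) ^ (p + 1) = 1 := by
    simp only [div_rpow (hupos _).le hN0.le, hNp]
    rw [integral_div, div_self hI.ne']
  have hpq : q.HolderConjugate (p + 1) := by
    rw [Real.holderConjugate_iff]
    refine ⟨hq, ?_⟩
    rw [hq_def]; field_simp
  have hyoung : ∫ t in (0:ℝ)..P, f t * (u t / N) ≤ 1 := by
    calc ∫ t in (0:ℝ)..P, f t * (u t / N)
        ≤ ∫ t in (0:ℝ)..P, (f t ^ q / q + (u t / N) ^ (p + 1) / (p + 1)) :=
          integral_mono_on hP.le ((hfc.mul hwc).intervalIntegrable _ _)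
            (((hfqc.div_const _).add (hwpc.div_const _)).intervalIntegrable _ _)
            fun t _ => Real.young_inequality_of_nonneg (hf0 t) (hw0 t).le hpq
      _ = (∫ t in (0:ℝ)..P, f t ^ q) / q + 1 / (p + 1) := by
          rw [integral_add ((hfqc.div_const _).intervalIntegrable _ _)
            ((hwpc.div_const _).intervalIntegrable _ _), integral_div, integral_div, hw1]
      _ ≤ 1 / q + 1 / (p + 1) := by gcongr
      _ = 1 := by simpa using hpq.inv_add_inv_eq_one
  have hJN : J f ≤ N := by
    simp only [← mul_div_assoc] at hyoung
    rwa [integral_div, hpair', div_le_one hN0] at hyoung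
  have hJ₀N : J₀ ≤ N := hfJ.trans hJN
  have hS : ∫ t in (0:ℝ)..P, |f t| ≤ P + 1 := by
    calc ∫ t in (0:ℝ)..P, |f t| ≤ ∫ t in (0:ℝ)..P, (1 + f t ^ q) := by
          refine integral_mono_on hP.le (hfc.abs.intervalIntegrable _ _)
            ((continuous_const.add hfqc).intervalIntegrable _ _) fun t _ => ?_
          rw [abs_of_nonneg (hf0 t)]
          rcases le_total (f t) 1 with h | h
          · linarith [rpow_nonneg (hf0 t) q]
          · linarith [self_le_rpow_of_one_le h hq.le]
      _ = P + ∫ t in (0:ℝ)..P, f t ^ q := by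
          rw [integral_add (by simp) (hfqc.intervalIntegrable _ _)]; simp
      _ ≤ P + 1 := by linarith
  have hDS : D * (∫ t in (0:ℝ)..P, |f t|) / N ≤ W := by
    rw [hW]; gcongr
  have hwW : ∀ t, u t / N ≤ W := fun t =>
    (div_le_div_of_nonneg_right ((le_abs_self _).trans (hbd t).1) hN0.le).trans hDS
  have hwW' : ∀ t, |d₁ t / N| ≤ W := fun t => by
    rw [abs_div, abs_of_pos hN0, hd₁]
    exact (div_le_div_of_nonneg_right (hbd t).2 hN0.le).trans hDS
  set g : ℝ → ℝ := fun t => (u t / N) ^ p with hg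
  have hgp : Periodic g P := fun t => by simp only [hg, hup t]
  have hgd : ∀ t, HasDerivAt g (d₁ t / N * p * (u t / N) ^ (p - 1)) t := fun t =>
    ((hud t).div_const N).rpow_const (Or.inl (hw0 t).ne')
  have hgK : g ∈ lipschitzPeriodic P (max 1 (W ^ p)) (max 1 (p * W ^ (p - 1) * W)) := by
    refine ⟨hgp, fun t => ⟨(rpow_pos_of_pos (hw0 t) _).le,
      (rpow_le_rpow (hw0 t).le (hwW t) hp0.le).trans (le_max_right _ _)⟩, fun s t => ?_⟩
    refine le_trans ?_ (mul_le_mul_of_nonneg_right (le_max_right _ _) (abs_nonneg _))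
    refine convex_univ.norm_image_sub_le_of_norm_hasDerivWithin_le
      (fun x _ => (hgd x).hasDerivWithinAt) (fun x _ => ?_) (Set.mem_univ t) (Set.mem_univ s)
    have h1 : (u x / N) ^ (p - 1) ≤ W ^ (p - 1) :=
      rpow_le_rpow (hw0 x).le (hwW x) (by linarith)
    have h2 := rpow_pos_of_pos (hw0 x) (p - 1)
    rw [Real.norm_eq_abs, abs_mul, abs_mul, abs_of_pos h2, abs_of_pos hp0]
    calc |d₁ x / N| * p * (u x / N) ^ (p - 1) ≤ W * p * W ^ (p - 1) := by
          gcongr; exact hwW' x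
      _ = p * W ^ (p - 1) * W := by ring
  have hgc := lipschitzPeriodic.continuous hgK
  have hgq : ∀ t, g t ^ q = (u t / N) ^ (p + 1) := fun t => by
    simp only [hg]
    rw [← rpow_mul (hw0 t).le, hq_def, mul_div_cancel₀ _ hp0.ne']
  have hg1 : ∫ t in (0:ℝ)..P, g t ^ q ≤ 1 := by simp only [hgq, hw1, le_refl]
  have hgJ : J g ≤ J f := hmax g hgK hg1
  have hgu : ∫ t in (0:ℝ)..P, g t * u t = N := by
    have : ∀ t, g t * u t = N * (u t / N) ^ (p + 1) := fun t => by
      rw [rpow_add_one (hw0 t).ne']; simp only [hg]; field_simp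
    simp only [this]
    rw [integral_const_mul, hw1, mul_one]
  have hBf := halfGreen_continuous hP ha hb hfc hfp
  have hBg := halfGreen_continuous hP ha hb hgc hgp
  have hsq : ∫ t in (0:ℝ)..P, (halfGreen P a b g t - halfGreen P a b f t) ^ 2 ≤ 0 := by
    have h1 := hadj g hgc hgp
    rw [hgu] at h1
    have h2 : ∀ t, (halfGreen P a b g t - halfGreen P a b f t) ^ 2
        = halfGreen P a b g t ^ 2 - 2 * (halfGreen P a b g t * halfGreen P a b f t)
          + halfGreen P a b f t ^ 2 := fun t => by ring
    simp only [h2]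
    rw [integral_add ((by fun_prop : Continuous _).intervalIntegrable _ _)
      ((by fun_prop : Continuous _).intervalIntegrable _ _),
      integral_sub ((by fun_prop : Continuous _).intervalIntegrable _ _)
      ((by fun_prop : Continuous _).intervalIntegrable _ _), integral_const_mul, ← h1]
    change J g - 2 * N + J f ≤ 0
    linarith
  have hBp : Periodic (fun t => halfGreen P a b g t - halfGreen P a b f t) P := fun t => by
    simp only [halfGreen_periodic hgp t, halfGreen_periodic hfp t]
  have hB0 : ∀ t, halfGreen P a b g t - halfGreen P a b f t = 0 := by
    by_contra! h
    obtain ⟨t, ht⟩ := h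
    obtain ⟨s, hs, hse⟩ := hBp.exists_mem_Ico₀ hP t
    refine absurd (integral_pos hP (by fun_prop) (fun _ _ => sq_nonneg _)
      ⟨s, ⟨hs.1, hs.2.le⟩, ?_⟩ :
      0 < ∫ t in (0:ℝ)..P, (halfGreen P a b g t - halfGreen P a b f t) ^ 2) hsq.not_gt
    rw [← hse]
    positivity
  have hgf : ∀ t, g t - f t = 0 := by
    refine halfGreen_eq_zero_imp hP ha hb (hgc.sub hfc)
      (fun t => by simp only [hgp t, hfp t]) fun t => ?_
    have h3 := congrFun (halfGreen_sub (b := b) hP ha hgc hgp hfc hfp) t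
    exact h3.trans (hB0 t)
  exact ⟨f, N, hfc, hfp, hf0, hJ₀N, hupos, fun t => (sub_eq_zero.1 (hgf t)).symm, hw1⟩

/-- A `P`-periodic tent of height `1/2` supported in `[-1, 1] + ℤP`. -/
noncomputable def periodicTent (P t : ℝ) : ℝ := 1 / 2 * max 0 (1 - ‖(t : AddCircle P)‖)

namespace periodicTent

variable {P : ℝ}

lemma mem_lipschitzPeriodic (P : ℝ) : periodicTent P ∈ lipschitzPeriodic P 1 1 := by
  refine ⟨fun t => ?_, fun t => ⟨by unfold periodicTent; positivity, ?_⟩, fun s t => ?_⟩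
  · simp only [periodicTent, AddCircle.coe_add_period]
  · have : max 0 (1 - ‖(t : AddCircle P)‖) ≤ 1 :=
      max_le zero_le_one (by linarith [norm_nonneg (t : AddCircle P)])
    unfold periodicTent
    linarith
  · have h1 := abs_norm_sub_norm_le (s : AddCircle P) (t : AddCircle P)
    rw [← AddCircle.coe_sub] at h1
    have h2 : ‖((s - t : ℝ) : AddCircle P)‖ ≤ |s - t| :=
      QuotientAddGroup.norm_mk_le_norm
    have h3 := abs_max_sub_max_le_abs (1 - ‖(s : AddCircle P)‖) (1 - ‖(t : AddCircle P)‖) 0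
    rw [sub_sub_sub_cancel_left, abs_sub_comm ‖(t : AddCircle P)‖] at h3
    unfold periodicTent
    rw [← mul_sub, abs_mul, max_comm 0, max_comm 0, abs_of_pos (by norm_num : (0:ℝ) < 1 / 2)]
    linarith [abs_nonneg (s - t)]

lemma eq_of_abs_le (hP : 0 < P) {t : ℝ} (ht : |t| ≤ P / 2) :
    periodicTent P t = 1 / 2 * max 0 (1 - |t|) := by
  rw [periodicTent, (AddCircle.norm_coe_eq_abs_iff P hP.ne').2 (by rwa [abs_of_pos hP])]

lemma integral_rpow_le (hP : 2 ≤ P) {q : ℝ} (hq : 1 < q) :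
    ∫ t in (0:ℝ)..P, periodicTent P t ^ q ≤ 1 := by
  have hP0 : 0 < P := by linarith
  have hmem := mem_lipschitzPeriodic P
  have hper : Periodic (fun t => periodicTent P t ^ q) P := fun t => by simp only [hmem.1 t]
  have hcont : Continuous fun t => periodicTent P t ^ q :=
    (lipschitzPeriodic.continuous hmem).rpow_const fun _ => Or.inr (by linarith)
  have hi : ∀ x y, IntervalIntegrable (fun t => periodicTent P t ^ q) MeasureTheory.volume x y :=
    fun x y => hcont.intervalIntegrable x y
  have h0 := hper.intervalIntegral_add_eq 0 (-(P / 2))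
  rw [zero_add, show -(P / 2) + P = P / 2 by ring] at h0
  have hzero : ∀ t, 1 ≤ |t| → |t| ≤ P / 2 → periodicTent P t ^ q = 0 := fun t h1 h2 => by
    rw [eq_of_abs_le hP0 h2, max_eq_left (by linarith), mul_zero, zero_rpow (by linarith)]
  have e1 : ∫ t in (-(P / 2))..(-1), periodicTent P t ^ q = 0 := by
    refine (integral_congr (g := fun _ => (0:ℝ)) fun t ht => ?_).trans (by simp)
    rw [Set.uIcc_of_le (by linarith)] at ht
    have : |t| = -t := abs_of_nonpos (by linarith [ht.2])
    exact hzero t (by linarith [ht.2]) (by linarith [ht.1])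
  have e2 : ∫ t in (1:ℝ)..(P / 2), periodicTent P t ^ q = 0 := by
    refine (integral_congr (g := fun _ => (0:ℝ)) fun t ht => ?_).trans (by simp)
    rw [Set.uIcc_of_le (by linarith)] at ht
    have : |t| = t := abs_of_nonneg (by linarith [ht.1])
    exact hzero t (by linarith [ht.1]) (by linarith [ht.2])
  have e3 : ∫ t in (-1:ℝ)..1, periodicTent P t ^ q ≤ ∫ _ in (-1:ℝ)..1, (1 / 2 : ℝ) := by
    refine integral_mono_on (by norm_num) (hi _ _) (by simp) fun t _ => ?_
    have h1 : periodicTent P t ≤ 1 / 2 := by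
      have : max 0 (1 - ‖(t : AddCircle P)‖) ≤ 1 :=
        max_le zero_le_one (by linarith [norm_nonneg (t : AddCircle P)])
      unfold periodicTent
      linarith
    exact (rpow_le_self_of_le_one (hmem.2.1 t).1 (hmem.2.1 t).2 hq.le).trans h1
  have e4 : ∫ _ in (-1:ℝ)..1, (1 / 2 : ℝ) = 1 := by norm_num
  rw [h0, ← integral_add_adjacent_intervals (hi _ (-1)) (hi _ _),
    ← integral_add_adjacent_intervals (hi (-1) 1) (hi _ _), e1, e2]
  linarith

/-- The quadratic form is bounded below on tents, uniformly in the period. -/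
lemma exists_le_integral_halfGreen_sq {a b : ℝ} (ha : 0 < a) (hb : 0 < b) :
    ∃ J₀ > 0, ∀ P, 2 ≤ P → J₀ ≤ ∫ t in (0:ℝ)..P, halfGreen P a b (periodicTent P) t ^ 2 := by
  set m : ℝ := 1 / 4 * exp (-(a * (1 / 4))) * (1 / 4) with hm
  set m' : ℝ := 1 / 4 * exp (-(b * (1 / 4))) * m with hm'
  have hm0 : 0 < m := by positivity
  have hm'0 : 0 < m' := by positivity
  refine ⟨1 / 2 * m' ^ 2, by positivity, fun P hP => ?_⟩
  have hP0 : 0 < P := by linarith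
  have hmem := mem_lipschitzPeriodic P
  have hc := lipschitzPeriodic.continuous hmem
  have hp := hmem.1
  have h1 : ∀ t, -(1 / 4) ≤ t → t ≤ 1 / 2 → m ≤ periodicResolvent P a (periodicTent P) t := by
    intro t ht1 ht2
    refine periodicResolvent.le_of_le_on hP0 ha hc hp (fun t => (hmem.2.1 t).1) (by norm_num)
      (by norm_num) fun s hs1 hs2 => ?_
    have hs : |s| ≤ 1 / 2 := abs_le.2 ⟨by linarith, by linarith⟩
    rw [eq_of_abs_le hP0 (by linarith)]
    linarith [le_max_right 0 (1 - |s|)]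
  have hc1 := periodicResolvent.continuous hP0 ha.ne' hc hp
  have h2 : ∀ t, 0 ≤ t → t ≤ 1 / 2 → m' ≤ halfGreen P a b (periodicTent P) t := by
    intro t ht1 ht2
    exact periodicResolvent.le_of_le_on hP0 hb hc1 (periodicResolvent.periodic hp)
      (periodicResolvent.nonneg hP0 ha fun t => (hmem.2.1 t).1) (by norm_num)
      hm0.le fun s hs1 hs2 => h1 s (by linarith) (by linarith)
  have hBc : Continuous fun t => halfGreen P a b (periodicTent P) t ^ 2 :=
    (halfGreen_continuous hP0 ha hb hc hp).pow 2
  have hi : ∀ x y, IntervalIntegrable (fun t => halfGreen P a b (periodicTent P) t ^ 2)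
      MeasureTheory.volume x y := fun x y => hBc.intervalIntegrable x y
  have h3 : ∫ _ in (0:ℝ)..(1 / 2), m' ^ 2
      ≤ ∫ t in (0:ℝ)..(1 / 2), halfGreen P a b (periodicTent P) t ^ 2 :=
    integral_mono_on (by norm_num) (by simp) (hi _ _) fun t ht =>
      pow_le_pow_left₀ hm'0.le (h2 t ht.1 ht.2) 2
  have h4 : 0 ≤ ∫ t in (1 / 2 : ℝ)..P, halfGreen P a b (periodicTent P) t ^ 2 :=
    integral_nonneg (by linarith) fun _ _ => sq_nonneg _
  rw [integral_const, smul_eq_mul, sub_zero] at h3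
  rw [← integral_add_adjacent_intervals (hi 0 (1 / 2)) (hi _ _)]
  linarith

end periodicTent

/-- For long periods the equation `(D² - a²)(D² - b²) v = v ^ p` has a positive periodic solution
with `v'' ≤ b² v` that takes arbitrarily small values. -/
lemma exists_periodic_solution_small_min {a b p ε : ℝ} (ha : 0 < a) (hb : 0 < b) (hp : 1 < p)
    (hε : 0 < ε) : ∃ P₀ : ℝ, 0 < P₀ ∧ ∀ P, P₀ ≤ P → ∃ v d₁ d₂ d₃ : ℝ → ℝ,
      Periodic v P ∧ (∀ t, 0 < v t) ∧ (∃ t, v t ≤ ε) ∧ (∀ t, d₂ t ≤ b ^ 2 * v t) ∧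
      (∀ t, HasDerivAt v (d₁ t) t) ∧ (∀ t, HasDerivAt d₁ (d₂ t) t) ∧
      (∀ t, HasDerivAt d₂ (d₃ t) t) ∧
      (∀ t, HasDerivAt d₃ (v t ^ p + (a ^ 2 + b ^ 2) * d₂ t - a ^ 2 * b ^ 2 * v t) t) := by
  obtain ⟨J₀, hJ₀, hJ⟩ := periodicTent.exists_le_integral_halfGreen_sq ha hb
  have hp0 : 0 < p := by linarith
  have hp1 : 0 < p - 1 := by linarith
  set A := J₀ ^ (-(p + 1) / (p - 1)) with hA
  have hA0 : 0 < A := rpow_pos_of_pos hJ₀ _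
  set P₁ := A / ε ^ (p + 1) + 1 with hP₁
  have hεp : 0 < ε ^ (p + 1) := rpow_pos_of_pos hε _
  refine ⟨max 2 P₁, by positivity, fun P hP => ?_⟩
  have hP2 : 2 ≤ P := (le_max_left _ _).trans hP
  have hP0 : 0 < P := by linarith
  have hPA : A < P * ε ^ (p + 1) := by
    have : A / ε ^ (p + 1) < P := by linarith [(le_max_right 2 P₁).trans hP]
    rwa [div_lt_iff₀ hεp] at this
  obtain ⟨f, N, hfc, hfp, hf0, hN, hu0, hfu, hint⟩ := exists_normalized_solution hP0 ha hb hp hJ₀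
    (periodicTent.mem_lipschitzPeriodic P)
    (periodicTent.integral_rpow_le hP2 (by rw [one_lt_div hp0]; linarith)) (hJ P hP2)
  obtain ⟨d₁, d₂, d₃, -, hd₂, h1, h2, h3, h4⟩ := periodicGreen_derivs hP0 ha hb hfc hfp
  have hup : Periodic (periodicGreen P a b f) P := periodicGreen_periodic hfp
  have hy := halfGreen_neg_nonpos hP0 ha hf0
  set u := periodicGreen P a b f with hu
  have huc : Continuous u := continuous_iff_continuousAt.2 fun t => (h1 t).continuousAt
  have hN0 : 0 < N := hJ₀.trans_le hN
  set k := N ^ (-p / (p - 1)) with hk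
  have hk0 : 0 < k := rpow_pos_of_pos hN0 _
  have hkN : (k * N) ^ p = k := by
    have : k * N = N ^ (-1 / (p - 1)) := by
      rw [hk, ← rpow_add_one hN0.ne']
      congr 1
      field_simp
      ring
    rw [this, ← rpow_mul hN0.le, hk]
    congr 1
    ring
  have hvw : ∀ t, k * u t = k * N * (u t / N) := fun t => by field_simp
  have hvp : ∀ t, (k * u t) ^ p = k * f t := fun t => by
    rw [hvw, mul_rpow (by positivity) (div_pos (hu0 t) hN0).le, hkN, hfu]
  refine ⟨fun t => k * u t, fun t => k * d₁ t, fun t => k * d₂ t, fun t => k * d₃ t,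
    fun t => by simp only [hup t], fun t => mul_pos hk0 (hu0 t), ?_, fun t => ?_,
    fun t => (h1 t).const_mul k, fun t => (h2 t).const_mul k, fun t => (h3 t).const_mul k,
    fun t => ((h4 t).const_mul k).congr_deriv ?_⟩
  · by_contra! h
    have hkN1 : (k * N) ^ (p + 1) = N ^ (-(p + 1) / (p - 1)) := by
      rw [rpow_add_one (by positivity), hkN, hk, ← mul_assoc, ← rpow_add hN0,
        ← rpow_add_one hN0.ne']
      congr 1
      field_simp
      ring
    have hNA : N ^ (-(p + 1) / (p - 1)) ≤ A :=
      rpow_le_rpow_of_nonpos hJ₀ hN (div_nonpos_of_nonpos_of_nonneg (by linarith) hp1.le)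
    have e1 : ∫ t in (0:ℝ)..P, (k * u t) ^ (p + 1) = (k * N) ^ (p + 1) := by
      have : ∀ t, (k * u t) ^ (p + 1) = (k * N) ^ (p + 1) * (u t / N) ^ (p + 1) := fun t => by
        rw [hvw, mul_rpow (by positivity) (div_pos (hu0 t) hN0).le]
      simp only [this]
      rw [integral_const_mul, hint, mul_one]
    have e2 : ∫ _ in (0:ℝ)..P, ε ^ (p + 1) ≤ ∫ t in (0:ℝ)..P, (k * u t) ^ (p + 1) :=
      integral_mono_on hP0.le (by simp)
        (((continuous_const.mul huc).rpow_const fun _ => Or.inr (by linarith)).intervalIntegrable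
          _ _) fun t _ => rpow_le_rpow hε.le (h t).le (by linarith)
    rw [integral_const, smul_eq_mul, sub_zero] at e2
    linarith
  · simp only [hd₂]
    nlinarith [mul_nonneg hk0.le (neg_nonneg.2 (hy t))]
  · simp only [hvp]; ring

/-- At a minimum of a twice differentiable function the second derivative is nonnegative. -/
lemma IsLocalMin.nonneg_of_hasDerivAt {v d₁ : ℝ → ℝ} {d₂ t : ℝ} (ht : IsLocalMin v t)
    (h1 : ∀ t, HasDerivAt v (d₁ t) t) (h2 : HasDerivAt d₁ d₂ t) : 0 ≤ d₂ := by
  by_contra! hneg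
  have hd : deriv v = d₁ := funext fun s => (h1 s).deriv
  have hmax : IsLocalMax v t := isLocalMax_of_deriv_deriv_neg (by rwa [hd, h2.deriv])
    ht.deriv_eq_zero (h1 t).continuousAt
  have hconst : v =ᶠ[nhds t] fun _ => v t := by
    filter_upwards [ht, hmax] with s hs1 hs2 using le_antisymm hs2 hs1
  have hd1 : d₁ =ᶠ[nhds t] fun _ => 0 := by
    rw [← hd]
    simpa using hconst.deriv
  have := hd1.deriv_eq
  rw [h2.deriv, deriv_const] at this
  exact hneg.ne this

/-- The a priori bound from conservation of the Hamiltonian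
`v' v''' - v''² / 2 - (a² + b²) v'² / 2 + a² b² v² / 2 - v ^ (p + 1) / (p + 1)`. -/
lemma rpow_le_of_hamiltonian {P a b p : ℝ} {v d₁ d₂ d₃ : ℝ → ℝ} (hP : 0 < P) (ha : 0 < a)
    (hb : 0 < b) (hab : p + 1 = 2 * a / b) (hper : Periodic v P)
    (hv : ∀ t, 0 < v t) (hsmall : ∃ t, v t ^ (p - 1) ≤ a * b * (a ^ 2 - b ^ 2)) (hp : 1 < p)
    (hd : ∀ t, d₂ t ≤ b ^ 2 * v t) (h1 : ∀ t, HasDerivAt v (d₁ t) t)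
    (h2 : ∀ t, HasDerivAt d₁ (d₂ t) t) (h3 : ∀ t, HasDerivAt d₂ (d₃ t) t)
    (h4 : ∀ t, HasDerivAt d₃ (v t ^ p + (a ^ 2 + b ^ 2) * d₂ t - a ^ 2 * b ^ 2 * v t) t)
    (t : ℝ) : v t ^ (p - 1) ≤ a ^ 3 * b := by
  have hp1 : 0 < p + 1 := by linarith
  set H : ℝ → ℝ := fun t => d₁ t * d₃ t - d₂ t ^ 2 / 2 - (a ^ 2 + b ^ 2) / 2 * d₁ t ^ 2
    + a ^ 2 * b ^ 2 / 2 * v t ^ 2 - v t ^ (p + 1) / (p + 1) with hH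
  have hH' : ∀ t, HasDerivAt H 0 t := fun t => by
    have e5 := ((h1 t).rpow_const (p := p + 1) (Or.inl (hv t).ne')).div_const (p + 1)
    rw [add_sub_cancel_right] at e5
    refine ((((((h2 t).mul (h4 t)).sub (((h3 t).pow 2).div_const 2)).sub
      (((h2 t).pow 2).const_mul ((a ^ 2 + b ^ 2) / 2))).add
      (((h1 t).pow 2).const_mul (a ^ 2 * b ^ 2 / 2))).sub e5).congr_deriv ?_
    push_cast
    field_simp
    ring
  have hHc : ∀ s t, H s = H t := is_const_of_deriv_eq_zero
    (fun t => (hH' t).differentiableAt) fun t => (hH' t).deriv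
  have hvc : Continuous v := continuous_iff_continuousAt.2 fun t => (h1 t).continuousAt
  have hmem : ∀ t, ∃ s ∈ Set.Icc 0 P, v t = v s := fun t => by
    obtain ⟨s, hs, hse⟩ := hper.exists_mem_Ico₀ hP t
    exact ⟨s, ⟨hs.1, hs.2.le⟩, hse⟩
  obtain ⟨x, -, hx⟩ := isCompact_Icc.exists_isMinOn (Set.nonempty_Icc.2 hP.le) hvc.continuousOn
  obtain ⟨y, -, hy⟩ := isCompact_Icc.exists_isMaxOn (Set.nonempty_Icc.2 hP.le) hvc.continuousOn
  have hx' : ∀ t, v x ≤ v t := fun t => by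
    obtain ⟨s, hs, hse⟩ := hmem t
    rw [hse]; exact hx hs
  have hy' : ∀ t, v t ≤ v y := fun t => by
    obtain ⟨s, hs, hse⟩ := hmem t
    rw [hse]; exact hy hs
  have hxl : IsLocalMin v x := Filter.Eventually.of_forall hx'
  have hyl : IsLocalMax v y := Filter.Eventually.of_forall hy'
  have hx1 := hxl.hasDerivAt_eq_zero (h1 x)
  have hy1 := hyl.hasDerivAt_eq_zero (h1 y)
  have hx2 := hxl.nonneg_of_hasDerivAt h1 (h2 x)
  have hpow : ∀ t, v t ^ (p + 1) = v t ^ (p - 1) * v t ^ 2 := fun t => by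
    rw [← rpow_natCast, ← rpow_add (hv t)]
    congr 1
    push_cast
    ring
  have hxs : v x ^ (p - 1) ≤ a * b * (a ^ 2 - b ^ 2) := by
    obtain ⟨s, hs⟩ := hsmall
    exact (rpow_le_rpow (hv x).le (hx' s) (by linarith)).trans hs
  have hdiv : ∀ z : ℝ, z / (p + 1) = z * (b / (2 * a)) := fun z => by
    rw [hab]; field_simp
  have hHx : 0 ≤ H x := by
    simp only [hH, hx1, hpow, hdiv]
    have k1 : d₂ x ^ 2 ≤ (b ^ 2 * v x) ^ 2 := pow_le_pow_left₀ hx2 (hd x) 2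
    have k2 : v x ^ (p - 1) * v x ^ 2 * (b / (2 * a))
        ≤ a * b * (a ^ 2 - b ^ 2) * v x ^ 2 * (b / (2 * a)) := by gcongr
    have k3 : a * b * (a ^ 2 - b ^ 2) * v x ^ 2 * (b / (2 * a))
        = b ^ 2 * (a ^ 2 - b ^ 2) / 2 * v x ^ 2 := by field_simp
    linarith
  have hHy : 0 ≤ H y := (hHc x y) ▸ hHx
  simp only [hH, hy1, hpow, hdiv] at hHy
  refine (rpow_le_rpow (hv t).le (hy' t) (by linarith)).trans ?_
  have k1 : v y ^ (p - 1) * v y ^ 2 * (b / (2 * a)) ≤ a ^ 2 * b ^ 2 / 2 * v y ^ 2 := by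
    linarith [sq_nonneg (d₂ y)]
  have k2 : 0 < v y ^ 2 * (b / (2 * a)) := mul_pos (pow_pos (hv y) 2) (by positivity)
  refine le_of_mul_le_mul_right ?_ k2
  calc v y ^ (p - 1) * (v y ^ 2 * (b / (2 * a))) ≤ a ^ 2 * b ^ 2 / 2 * v y ^ 2 := by linarith
    _ = a ^ 3 * b * (v y ^ 2 * (b / (2 * a))) := by field_simp

/-- A constant `v` solving the equation satisfies `v ^ (p - 1) = a² b²`. -/
lemma rpow_sub_one_eq_of_const {a b p : ℝ} {v d₁ d₂ d₃ : ℝ → ℝ} (hv : ∀ t, 0 < v t)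
    (hc : ∀ s t, v s = v t) (h1 : ∀ t, HasDerivAt v (d₁ t) t)
    (h2 : ∀ t, HasDerivAt d₁ (d₂ t) t) (h3 : ∀ t, HasDerivAt d₂ (d₃ t) t)
    (h4 : ∀ t, HasDerivAt d₃ (v t ^ p + (a ^ 2 + b ^ 2) * d₂ t - a ^ 2 * b ^ 2 * v t) t)
    (t : ℝ) : v t ^ (p - 1) = a ^ 2 * b ^ 2 := by
  have hzero : ∀ {f g : ℝ → ℝ} {k : ℝ}, (∀ t, HasDerivAt f (g t) t) → f = (fun _ => k) →
      g = fun _ => 0 := by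
    intro f g k hfg hf
    subst hf
    exact funext fun t => (hfg t).unique (hasDerivAt_const t k)
  have e1 := hzero h1 (funext fun s => hc s 0)
  have e2 := hzero h2 e1
  have e3 := hzero h3 e2
  have e4 := congrFun (hzero h4 e3) t
  simp only [e2] at e4
  rw [rpow_sub_one (hv t).ne', div_eq_iff (hv t).ne']
  linarith

/-- For `n ≥ 5` there is `T₀ > 0` such that for every `T ≥ T₀` the
equation `v'''' + K₂ v'' + K₀ v = v^((n+4)/(n-4))` has a positive nonconstant
`2T`-periodic `C⁴` solution `v` with `0 < v ≤ L = (n³(n-4)/16)^((n-4)/8)`. -/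
theorem exists_periodic_solution (n : ℕ) (hn : 5 ≤ n) :
    ∃ T₀ : ℝ, 0 < T₀ ∧ ∀ T : ℝ, T₀ ≤ T →
      ∃ v : ℝ → ℝ, ContDiff ℝ 4 v ∧
        (∀ t : ℝ, 0 < v t ∧ v t ≤ ((n:ℝ)^3 * ((n:ℝ) - 4) / 16) ^ (((n:ℝ) - 4) / 8)) ∧
        Function.Periodic v (2 * T) ∧
        (∃ a b : ℝ, v a ≠ v b) ∧
        ∀ t : ℝ,
          iteratedDeriv 4 v t + (-(((n:ℝ)^2 - 4*(n:ℝ) + 8) / 2)) * iteratedDeriv 2 v t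
            + ((n:ℝ)^2 * ((n:ℝ) - 4)^2 / 16) * v t
            = v t ^ (((n:ℝ) + 4) / ((n:ℝ) - 4)) := by
  have hn' : (5:ℝ) ≤ n := by exact_mod_cast hn
  set x : ℝ := (n : ℝ) with hx
  have hx4 : 0 < x - 4 := by linarith
  set a : ℝ := x / 2 with ha_def
  set b : ℝ := (x - 4) / 2 with hb_def
  set p : ℝ := (x + 4) / (x - 4) with hp_def
  have ha : 0 < a := by rw [ha_def]; linarith
  have hb : 0 < b := by rw [hb_def]; linarith
  have hp : 1 < p := by rw [hp_def, one_lt_div hx4]; linarith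
  have hp1 : 0 < p - 1 := by linarith
  have hpb : p + 1 = 2 * a / b := by rw [hp_def, ha_def, hb_def]; field_simp; ring
  have hpinv : (p - 1)⁻¹ = (x - 4) / 8 := by rw [hp_def]; field_simp; ring
  have hab : 0 < a ^ 2 - b ^ 2 := by rw [ha_def, hb_def]; nlinarith
  set δ : ℝ := min (a * b * (a ^ 2 - b ^ 2)) (a ^ 2 * b ^ 2 / 2) with hδ
  have hδ0 : 0 < δ := lt_min (by positivity) (by positivity)
  obtain ⟨P₀, hP₀, hsol⟩ := exists_periodic_solution_small_min ha hb hp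
    (rpow_pos_of_pos hδ0 (p - 1)⁻¹)
  refine ⟨P₀, hP₀, fun T hT => ?_⟩
  have hT0 : 0 < 2 * T := by linarith
  obtain ⟨v, d₁, d₂, d₃, hper, hv, ⟨s, hs⟩, hd, h1, h2, h3, h4⟩ := hsol (2 * T) (by linarith)
  have hs' : v s ^ (p - 1) ≤ δ := by
    have := rpow_le_rpow (hv s).le hs hp1.le
    rwa [rpow_inv_rpow hδ0.le hp1.ne'] at this
  have hbound := rpow_le_of_hamiltonian hT0 ha hb hpb hper hv
    ⟨s, hs'.trans (min_le_left _ _)⟩ hp hd h1 h2 h3 h4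
  have i1 : deriv v = d₁ := funext fun t => (h1 t).deriv
  have i2 : deriv d₁ = d₂ := funext fun t => (h2 t).deriv
  have i3 : deriv d₂ = d₃ := funext fun t => (h3 t).deriv
  have j2 : iteratedDeriv 2 v = d₂ := by
    rw [iteratedDeriv_succ, iteratedDeriv_one, i1, i2]
  have j3 : iteratedDeriv 3 v = d₃ := by rw [iteratedDeriv_succ, j2, i3]
  have j4 : iteratedDeriv 4 v = fun t =>
      v t ^ p + (a ^ 2 + b ^ 2) * d₂ t - a ^ 2 * b ^ 2 * v t := by
    rw [iteratedDeriv_succ, j3]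
    exact funext fun t => (h4 t).deriv
  have cont : ∀ {f g : ℝ → ℝ}, (∀ t, HasDerivAt f (g t) t) → Continuous f := fun h =>
    continuous_iff_continuousAt.2 fun t => (h t).continuousAt
  have diff : ∀ {f g : ℝ → ℝ}, (∀ t, HasDerivAt f (g t) t) → Differentiable ℝ f := fun h t =>
    (h t).differentiableAt
  refine ⟨v, ?_, fun t => ⟨hv t, ?_⟩, hper, ?_, fun t => ?_⟩
  · refine contDiff_nat_iff_iteratedDeriv.2 ⟨fun m hm => ?_, fun m hm => ?_⟩
    · interval_cases m
      · simpa using cont h1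
      · simpa [i1] using cont h2
      · simpa [j2] using cont h3
      · simpa [j3] using cont h4
      · rw [j4]
        have c0 := (cont h1).rpow_const (p := p) fun _ => Or.inr (by linarith)
        have c1 := cont h1
        have c2 := cont h3
        fun_prop
    · interval_cases m
      · simpa using diff h1
      · simpa [i1] using diff h2
      · simpa [j2] using diff h3
      · simpa [j3] using diff h4
  · have e : x ^ 3 * (x - 4) / 16 = a ^ 3 * b := by rw [ha_def, hb_def]; ring
    have := rpow_le_rpow (rpow_nonneg (hv t).le _) (hbound t) (inv_pos.2 hp1).le
    rwa [rpow_rpow_inv (hv t).le hp1.ne', hpinv, ← e] at this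
  · by_contra! hc
    have e1 := rpow_sub_one_eq_of_const hv hc h1 h2 h3 h4 s
    have e2 := hs'.trans (min_le_right _ _)
    have : 0 < a ^ 2 * b ^ 2 := by positivity
    linarith
  · rw [j4, j2, ha_def, hb_def]
    ring
end

section
/- Let n ≥ 5, let t₁ < t₂ be real numbers, and let v₀ ∈ C⁴([t₁,t₂]) be a nonnegative function satisfying equation (∗) on [t₁,t₂] together with the boundary conditions v₀'(t₁) = v₀'(t₂) = v₀'''(t₁) = v₀'''(t₂) = 0. Then there exists a 2(t₂ - t₁)-periodic function v ∈ C⁴(ℝ) which solves equation (∗) on all of ℝ and agrees with v₀ on [t₁, t₂]; v is obtained by the even reflection v(t) = v₀(2t₂ - t) for t ∈ [t₂, 2t₂ - t₁] followed by 2(t₂-t₁)-periodic extension. -/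
open Set

/-- A property that holds on `[a, b]`, is invariant under reflection about `b` and has period
`2 * (b - a)` holds everywhere. -/
theorem forall_of_reflection_of_periodic {a b : ℝ} (hab : a < b) {P : ℝ → Prop}
    (hP : ∀ t ∈ Icc a b, P t) (hrefl : ∀ t, P t → P (2 * b - t))
    (hper : Function.Periodic P (2 * (b - a))) (t : ℝ) : P t := by
  obtain ⟨u, hu, hPu⟩ := hper.exists_mem_Ico (by linarith) t a
  rw [hPu]
  rcases le_or_gt u b with hub | hub
  · exact hP u ⟨hu.1, hub⟩
  · have h := hrefl _ (hP (2 * b - u) ⟨by linarith [hu.2], by linarith⟩)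
    rwa [sub_sub_cancel] at h

/-- A function on `[a, b]` satisfying the compatibility conditions at the endpoints extends to a
`2 * (b - a)`-periodic function which is even (`σ = 1`) or odd (`σ = -1`) about `b`. -/
theorem exists_periodic_reflection_extension {a b σ : ℝ} (hab : a < b) (hσ : σ * σ = 1)
    (f : ℝ → ℝ) (ha : f a = σ * f a) (hb : f b = σ * f b) :
    ∃ F : ℝ → ℝ, EqOn F f (Icc a b) ∧ (∀ t, F (2 * b - t) = σ * F t) ∧
      Function.Periodic F (2 * (b - a)) := by
  have hL : 0 < 2 * (b - a) := by linarith
  let g : ℝ → ℝ := fun u => if u ≤ b then f u else σ * f (2 * b - u)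
  let F : ℝ → ℝ := fun t => g (toIcoMod hL a t)
  have hF : ∀ u ∈ Ico a (a + 2 * (b - a)), F u = g u := fun u hu =>
    congrArg g ((toIcoMod_eq_self hL).2 hu)
  have hper : Function.Periodic F (2 * (b - a)) := fun t =>
    congrArg g (toIcoMod_add_right hL a t)
  have hIcc : EqOn F f (Icc a b) := fun t ht => by
    rw [hF t ⟨ht.1, by linarith [ht.2]⟩]
    exact if_pos ht.2
  refine ⟨F, hIcc, fun t => ?_, hper⟩
  obtain ⟨u, hu, htu⟩ := Function.Periodic.exists_mem_Ico
    (f := fun t => F (2 * b - t) = σ * F t) (fun t => by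
      beta_reduce
      rw [hper t, ← hper (2 * b - (t + 2 * (b - a)))]
      ring_nf) hL t a
  rw [htu]
  rcases hu.1.eq_or_lt with rfl | hau
  · rw [show 2 * b - a = a + 2 * (b - a) by ring, hper, hIcc (left_mem_Icc.2 hab.le)]
    exact ha
  rw [hF u hu, hF (2 * b - u) ⟨by linarith [hu.2], by linarith⟩]
  rcases lt_trichotomy u b with hub | rfl | hub
  · simp only [g, if_pos hub.le, if_neg (show ¬ 2 * b - u ≤ b by linarith), sub_sub_cancel]
  · simpa [g, two_mul] using hb
  · simp only [g, if_neg hub.not_ge, if_pos (show 2 * b - u ≤ b by linarith), ← mul_assoc, hσ,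
      one_mul]

/-- If `F` and `G` are `2 * (b - a)`-periodic with opposite parities about `b` and `G` is the
derivative of `F` within `[a, b]`, then `G` is the derivative of `F` everywhere. -/
theorem hasDerivAt_of_reflection_of_periodic {a b σ : ℝ} (hab : a < b) (hσ : σ * σ = 1)
    {F G : ℝ → ℝ} (hF : ∀ t, F (2 * b - t) = σ * F t) (hG : ∀ t, G (2 * b - t) = -σ * G t)
    (hFper : Function.Periodic F (2 * (b - a))) (hGper : Function.Periodic G (2 * (b - a)))
    (hd : ∀ t ∈ Icc a b, HasDerivWithinAt F (G t) (Icc a b) t) (t : ℝ) :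
    HasDerivAt F (G t) t := by
  have hFσ : F = fun s => σ * F (2 * b - s) := by
    funext s
    rw [hF, ← mul_assoc, hσ, one_mul]
  have hGσ : ∀ s, G s = -(σ * G (2 * b - s)) := fun s => by
    rw [hG]
    linear_combination (-G s) * hσ
  have hreflW : ∀ (s : ℝ) (S S' : Set ℝ), MapsTo (fun x => 2 * b - x) S' S →
      HasDerivWithinAt F (G s) S s → HasDerivWithinAt F (G (2 * b - s)) S' (2 * b - s) := by
    intro s S S' hS h
    have h1 : HasDerivWithinAt (fun x : ℝ => 2 * b - x) (-1) S' (2 * b - s) :=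
      ((hasDerivAt_id' (2 * b - s)).const_sub (2 * b)).hasDerivWithinAt
    have h2 : HasDerivWithinAt F (G s) S (2 * b - (2 * b - s)) := by rwa [sub_sub_cancel]
    have h3 := (h2.comp (2 * b - s) h1 hS).const_mul σ
    rw [hFσ, hGσ, sub_sub_cancel]
    exact h3.congr_deriv (by ring)
  have hshift : ∀ (s c : ℝ) (S S' : Set ℝ), (∀ x, F (x + c) = F x) → (∀ x, G (x + c) = G x) →
      MapsTo (fun x => x + c) S' S →
      HasDerivWithinAt F (G (s + c)) S (s + c) → HasDerivWithinAt F (G s) S' s := by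
    intro s c S S' hFc hGc hS h
    have h1 : HasDerivWithinAt (fun x : ℝ => x + c) 1 S' s :=
      ((hasDerivAt_id' s).add_const c).hasDerivWithinAt
    have h3 := h.comp s h1 hS
    rw [mul_one, hGc] at h3
    exact h3.congr (fun x _ => (hFc x).symm) (hFc s).symm
  have hFneg : ∀ x, F (x + -(2 * (b - a))) = F x := fun x => by
    rw [← sub_eq_add_neg, hFper.sub_eq]
  have hGneg : ∀ x, G (x + -(2 * (b - a))) = G x := fun x => by
    rw [← sub_eq_add_neg, hGper.sub_eq]
  refine forall_of_reflection_of_periodic (P := fun t => HasDerivAt F (G t) t) hab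
    (fun s hs => ?_) (fun s hs => ?_) (fun s => propext ⟨fun h => ?_, fun h => ?_⟩) t
  · have hdb : HasDerivWithinAt F (G s) (Icc b (2 * b - a)) s ∨ s < b := by
      rcases hs.2.eq_or_lt with rfl | h
      · left
        have := hreflW s (Icc a s) (Icc s (2 * s - a))
          (fun x hx => ⟨by linarith [hx.2], by linarith [hx.1]⟩) (hd s hs)
        rwa [show 2 * s - s = s by ring] at this
      · exact Or.inr h
    have hda : HasDerivWithinAt F (G s) (Icc (2 * a - b) a) s ∨ a < s := by
      rcases hs.1.eq_or_lt with rfl | h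
      · left
        have h1 := hreflW a (Icc a b) (Icc b (2 * b - a))
          (fun x hx => ⟨by linarith [hx.2], by linarith [hx.1]⟩) (hd a hs)
        refine hshift a (2 * (b - a)) (Icc b (2 * b - a)) _ hFper hGper
          (fun x hx => ⟨by linarith [hx.1], by linarith [hx.2]⟩) ?_
        rwa [show a + 2 * (b - a) = 2 * b - a by ring]
      · exact Or.inr h
    rcases hda with hda | hda
    · rcases hdb with hdb | hdb
      · refine ((hda.union (hd s hs)).union hdb).hasDerivAt ?_
        rw [Icc_union_Icc_eq_Icc (by linarith) hab.le,
          Icc_union_Icc_eq_Icc (by linarith) (by linarith)]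
        exact Icc_mem_nhds (by linarith [hs.1]) (by linarith [hs.2])
      · refine (hda.union (hd s hs)).hasDerivAt ?_
        rw [Icc_union_Icc_eq_Icc (by linarith) hab.le]
        exact Icc_mem_nhds (by linarith [hs.1]) hdb
    · rcases hdb with hdb | hdb
      · refine ((hd s hs).union hdb).hasDerivAt ?_
        rw [Icc_union_Icc_eq_Icc hab.le (by linarith)]
        exact Icc_mem_nhds hda (by linarith [hs.2])
      · exact (hd s hs).hasDerivAt (Icc_mem_nhds hda hdb)
  · exact (hreflW s univ univ (mapsTo_univ _ _) hs.hasDerivWithinAt).hasDerivAt Filter.univ_mem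
  · exact (hshift s (2 * (b - a)) univ univ hFper hGper (mapsTo_univ _ _)
      h.hasDerivWithinAt).hasDerivAt Filter.univ_mem
  · refine (hshift (s + 2 * (b - a)) (-(2 * (b - a))) univ univ hFneg hGneg (mapsTo_univ _ _)
      ?_).hasDerivAt Filter.univ_mem
    rw [add_neg_cancel_right]
    exact h.hasDerivWithinAt


/-- For `n ≥ 5`, a nonnegative `C⁴` solution `v₀` of
`v'''' + K₂ v'' + K₀ v = v^((n+4)/(n-4))` on `[t₁,t₂]` with vanishing first and third
derivatives at both endpoints extends, by even reflection about `t₂` and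
`2(t₂-t₁)`-periodic continuation, to a `2(t₂-t₁)`-periodic `C⁴` solution on all of `ℝ`. -/
theorem periodic_extension (n : ℕ) (hn : 5 ≤ n) (t₁ t₂ : ℝ) (h12 : t₁ < t₂)
    (v₀ : ℝ → ℝ)
    (hreg : ContDiffOn ℝ 4 v₀ (Set.Icc t₁ t₂))
    (hnonneg : ∀ t ∈ Set.Icc t₁ t₂, 0 ≤ v₀ t)
    (heq : ∀ t ∈ Set.Icc t₁ t₂,
      iteratedDerivWithin 4 v₀ (Set.Icc t₁ t₂) t
        + (-(((n:ℝ)^2 - 4*(n:ℝ) + 8) / 2)) * iteratedDerivWithin 2 v₀ (Set.Icc t₁ t₂) t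
        + ((n:ℝ)^2 * ((n:ℝ) - 4)^2 / 16) * v₀ t
        = v₀ t ^ (((n:ℝ) + 4) / ((n:ℝ) - 4)))
    (hbc1 : iteratedDerivWithin 1 v₀ (Set.Icc t₁ t₂) t₁ = 0)
    (hbc2 : iteratedDerivWithin 1 v₀ (Set.Icc t₁ t₂) t₂ = 0)
    (hbc3 : iteratedDerivWithin 3 v₀ (Set.Icc t₁ t₂) t₁ = 0)
    (hbc4 : iteratedDerivWithin 3 v₀ (Set.Icc t₁ t₂) t₂ = 0) :
    ∃ v : ℝ → ℝ, ContDiff ℝ 4 v ∧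
      Function.Periodic v (2 * (t₂ - t₁)) ∧
      (∀ t ∈ Set.Icc t₁ t₂, v t = v₀ t) ∧
      (∀ t ∈ Set.Icc t₂ (2 * t₂ - t₁), v t = v₀ (2 * t₂ - t)) ∧
      ∀ t : ℝ,
        iteratedDeriv 4 v t + (-(((n:ℝ)^2 - 4*(n:ℝ) + 8) / 2)) * iteratedDeriv 2 v t
          + ((n:ℝ)^2 * ((n:ℝ) - 4)^2 / 16) * v t
          = v t ^ (((n:ℝ) + 4) / ((n:ℝ) - 4)) := by
  have huniq : UniqueDiffOn ℝ (Icc t₁ t₂) := uniqueDiffOn_Icc h12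
  have hbc : ∀ k ≤ 4, ∀ t ∈ ({t₁, t₂} : Set ℝ), iteratedDerivWithin k v₀ (Icc t₁ t₂) t
      = (-1) ^ k * iteratedDerivWithin k v₀ (Icc t₁ t₂) t := by
    intro k hk t ht
    rcases ht with rfl | rfl <;> interval_cases k <;> norm_num [hbc1, hbc2, hbc3, hbc4]
  have hσ : ∀ k : ℕ, (-1 : ℝ) ^ k * (-1) ^ k = 1 := fun k => by
    rw [← mul_pow, neg_one_mul, neg_neg, one_pow]
  choose! F hFeq hFrefl hFper using fun k (hk : k ≤ 4) =>
    exists_periodic_reflection_extension h12 (hσ k) (iteratedDerivWithin k v₀ (Icc t₁ t₂))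
      (hbc k hk t₁ (by simp)) (hbc k hk t₂ (by simp))
  have hderiv : ∀ k < 4, ∀ t, HasDerivAt (F k) (F (k + 1) t) t := by
    intro k hk
    refine hasDerivAt_of_reflection_of_periodic h12 (hσ k) (hFrefl k hk.le)
      (fun t => by rw [hFrefl (k + 1) hk, pow_succ, mul_neg_one]) (hFper k hk.le)
      (hFper (k + 1) hk) fun t ht => ?_
    have hdiff := hreg.differentiableOn_iteratedDerivWithin (m := k) (by exact_mod_cast hk) huniq
    have := (hdiff t ht).hasDerivWithinAt
    rw [← iteratedDerivWithin_succ, ← hFeq (k + 1) hk ht] at this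
    exact this.congr (hFeq k hk.le) (hFeq k hk.le ht)
  have hiter : ∀ k ≤ 4, iteratedDeriv k (F 0) = F k := by
    intro k
    induction k with
    | zero => intro _; exact iteratedDeriv_zero
    | succ k ih =>
      intro hk
      rw [iteratedDeriv_succ, ih (by omega)]
      exact funext fun t => (hderiv k hk t).deriv
  have hF0 : EqOn (F 0) v₀ (Icc t₁ t₂) := fun t ht => by
    rw [hFeq 0 (by norm_num) ht, iteratedDerivWithin_zero]
  have hr0 : ∀ t, F 0 (2 * t₂ - t) = F 0 t := fun t => by simpa using hFrefl 0 (by norm_num) t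
  have hr2 : ∀ t, F 2 (2 * t₂ - t) = F 2 t := fun t => by simpa using hFrefl 2 (by norm_num) t
  have hr4 : ∀ t, F 4 (2 * t₂ - t) = F 4 t := fun t => by
    simpa [show (-1 : ℝ) ^ 4 = 1 by norm_num] using hFrefl 4 le_rfl t
  have hode : ∀ t, F 4 t + (-(((n:ℝ)^2 - 4*(n:ℝ) + 8) / 2)) * F 2 t
      + ((n:ℝ)^2 * ((n:ℝ) - 4)^2 / 16) * F 0 t = F 0 t ^ (((n:ℝ) + 4) / ((n:ℝ) - 4)) := by
    refine forall_of_reflection_of_periodic h12 (fun t ht => ?_) (fun t ht => ?_) (fun t => ?_)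
    · rw [hFeq 4 le_rfl ht, hFeq 2 (by norm_num) ht, hF0 ht]
      exact heq t ht
    · rwa [hr0, hr2, hr4]
    · rw [hFper 0 (by norm_num), hFper 2 (by norm_num), hFper 4 le_rfl]
  have hcont : ∀ k < 4, Continuous (F k) := fun k hk =>
    continuous_iff_continuousAt.2 fun t => (hderiv k hk t).continuousAt
  have hcont4 : Continuous (F 4) := by
    have hn' : (5 : ℝ) ≤ n := by exact_mod_cast hn
    have hp : 0 ≤ ((n:ℝ) + 4) / ((n:ℝ) - 4) := div_nonneg (by linarith) (by linarith)
    have h0 := hcont 0 (by norm_num)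
    have h2 := hcont 2 (by norm_num)
    rw [show F 4 = fun t => F 0 t ^ (((n:ℝ) + 4) / ((n:ℝ) - 4))
      - (-(((n:ℝ)^2 - 4*(n:ℝ) + 8) / 2)) * F 2 t - ((n:ℝ)^2 * ((n:ℝ) - 4)^2 / 16) * F 0 t from
      funext fun t => by linear_combination hode t]
    exact ((h0.rpow_const fun _ => Or.inr hp).sub (continuous_const.mul h2)).sub
      (continuous_const.mul h0)
  refine ⟨F 0, ?_, hFper 0 (by norm_num), hF0, fun t ht => ?_, ?_⟩
  · refine contDiff_nat_iff_iteratedDeriv (n := 4) |>.2 ⟨fun m hm => ?_, fun m hm => ?_⟩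
    · rw [hiter m hm]
      rcases hm.eq_or_lt with rfl | hm
      · exact hcont4
      · exact hcont m hm
    · rw [hiter m hm.le]
      exact fun t => (hderiv m hm t).differentiableAt
  · rw [← hr0]
    exact hF0 ⟨by linarith [ht.2], by linarith [ht.1]⟩
  · rw [hiter 4 le_rfl, hiter 2 (by norm_num)]
    exact hode
end

section
/- Let n ≥ 5 and let v ∈ C⁴(ℝ) be a nonnegative periodic solution of equation (∗) which is not identically zero. Then v(t) > 0 for all t ∈ ℝ. -/
/-- A differential inequality `y' ≤ c y` makes `exp (-c t) y` antitone. -/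
lemma antitone_exp_mul_of_deriv_le {y y' : ℝ → ℝ} {c : ℝ}
    (hy : ∀ t, HasDerivAt y (y' t) t) (hle : ∀ t, y' t ≤ c * y t) :
    Antitone fun t => Real.exp (-c * t) * y t := by
  have hd : ∀ t, HasDerivAt (fun t => Real.exp (-c * t) * y t)
      (Real.exp (-c * t) * (y' t - c * y t)) t := fun t => by
    have he : HasDerivAt (fun t => Real.exp (-c * t)) (Real.exp (-c * t) * (-c * 1)) t :=
      ((hasDerivAt_id t).const_mul (-c)).exp
    exact (he.mul (hy t)).congr_deriv (by ring)
  refine antitone_of_deriv_nonpos (fun t => (hd t).differentiableAt) fun t => ?_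
  rw [(hd t).deriv]
  exact mul_nonpos_of_nonneg_of_nonpos (Real.exp_pos _).le (sub_nonpos.2 (hle t))

/-- A periodic function with `y' ≤ c y` has the sign of `c`. -/
lemma Function.Periodic.mul_nonneg_of_deriv_le {y y' : ℝ → ℝ} {c T : ℝ} (hT : 0 < T)
    (hper : Function.Periodic y T) (hy : ∀ t, HasDerivAt y (y' t) t)
    (hle : ∀ t, y' t ≤ c * y t) (t : ℝ) : 0 ≤ c * y t := by
  have h : Real.exp (-c * (t + T)) * y (t + T) ≤ Real.exp (-c * t) * y t :=
    antitone_exp_mul_of_deriv_le hy hle (le_add_of_nonneg_right hT.le)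
  rw [hper t, mul_add, Real.exp_add, mul_assoc] at h
  have h1 : Real.exp (-c * T) * y t ≤ y t := le_of_mul_le_mul_left h (Real.exp_pos _)
  rcases lt_trichotomy c 0 with hc | rfl | hc
  · have : 1 < Real.exp (-c * T) := Real.one_lt_exp_iff.2 (mul_pos (neg_pos.2 hc) hT)
    have : y t ≤ 0 := by nlinarith
    exact mul_nonneg_of_nonpos_of_nonpos hc.le this
  · simp
  · have : Real.exp (-c * T) < 1 := Real.exp_lt_one_iff.2 (by nlinarith)
    have : 0 ≤ y t := by nlinarith
    exact mul_nonneg hc.le this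

/-- Maximum principle: a periodic function with `w'' ≥ α² w` is nonpositive. -/
lemma Function.Periodic.nonpos_of_sq_mul_le_deriv2 {w w' w'' : ℝ → ℝ} {α T : ℝ} (hα : 0 < α)
    (hT : 0 < T) (hper : Function.Periodic w T) (hper' : Function.Periodic w' T)
    (hw : ∀ t, HasDerivAt w (w' t) t) (hw' : ∀ t, HasDerivAt w' (w'' t) t)
    (hle : ∀ t, α ^ 2 * w t ≤ w'' t) (t : ℝ) : w t ≤ 0 := by
  have h1 : ∀ t, 0 ≤ α * -(w' t + α * w t) :=
    Function.Periodic.mul_nonneg_of_deriv_le (y := fun t => -(w' t + α * w t))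
      (y' := fun t => -(w'' t + α * w' t)) hT (fun t => by simp only [hper t, hper' t])
      (fun t => ((hw' t).add ((hw t).const_mul α)).neg) (fun t => by linarith [hle t])
  have h2 : 0 ≤ -α * w t := by
    refine Function.Periodic.mul_nonneg_of_deriv_le hT hper hw (fun t => ?_) t
    linarith [nonneg_of_mul_nonneg_right (h1 t) hα]
  nlinarith

/-- If `v'' ≤ β² v` and `v`, `v'` vanish at `a`, then `v ≤ 0` to the right of `a`. -/
lemma nonpos_of_deriv2_le_sq_mul {v v' v'' : ℝ → ℝ} {β a : ℝ}
    (hv : ∀ t, HasDerivAt v (v' t) t) (hv' : ∀ t, HasDerivAt v' (v'' t) t)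
    (hle : ∀ t, v'' t ≤ β ^ 2 * v t) (ha : v a = 0) (ha' : v' a = 0) {t : ℝ} (hat : a ≤ t) :
    v t ≤ 0 := by
  have hanti : Antitone fun t => Real.exp (-(-β) * t) * (v' t - β * v t) :=
    antitone_exp_mul_of_deriv_le (y' := fun t => v'' t - β * v' t)
      (fun t => (hv' t).sub ((hv t).const_mul β)) (fun t => by linarith [hle t])
  have h1 : ∀ s, a ≤ s → v' s - β * v s ≤ 0 := fun s hs => by
    have := hanti hs
    simp only [ha, ha', mul_zero, sub_zero] at this
    exact nonpos_of_mul_nonpos_right this (Real.exp_pos _)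
  have hd : ∀ t, HasDerivAt (fun t => Real.exp (-β * t) * v t)
      (Real.exp (-β * t) * (v' t - β * v t)) t := fun t => by
    have he : HasDerivAt (fun t => Real.exp (-β * t)) (Real.exp (-β * t) * (-β * 1)) t :=
      ((hasDerivAt_id t).const_mul (-β)).exp
    exact (he.mul (hv t)).congr_deriv (by ring)
  have hanti2 : AntitoneOn (fun t => Real.exp (-β * t) * v t) (Set.Ici a) := by
    refine antitoneOn_of_deriv_nonpos (convex_Ici a)
      (fun t _ => (hd t).continuousAt.continuousWithinAt)
      (fun t _ => (hd t).differentiableAt.differentiableWithinAt) fun s hs => ?_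
    rw [(hd s).deriv]
    exact mul_nonpos_of_nonneg_of_nonpos (Real.exp_pos _).le (h1 s (interior_subset hs))
  have := hanti2 Set.self_mem_Ici hat hat
  simp only [ha, mul_zero] at this
  exact nonpos_of_mul_nonpos_right this (Real.exp_pos _)

lemma Function.Periodic.iteratedDeriv {v : ℝ → ℝ} {T : ℝ} (h : Function.Periodic v T) (k : ℕ) :
    Function.Periodic (iteratedDeriv k v) T := fun t => by
  have := iteratedDeriv_comp_add_const k v T
  rw [show (fun z => v (z + T)) = v from funext h] at this
  exact (congrFun this t).symm


/-- For `n ≥ 5`, a nonnegative periodic `C⁴` solution of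
`v'''' + K₂ v'' + K₀ v = v^((n+4)/(n-4))` which is not identically zero is
everywhere positive. -/
theorem periodic_solution_positive (n : ℕ) (hn : 5 ≤ n) (v : ℝ → ℝ)
    (hreg : ContDiff ℝ 4 v) (hnonneg : ∀ t : ℝ, 0 ≤ v t)
    (hper : ∃ T : ℝ, 0 < T ∧ Function.Periodic v T)
    (hne : ∃ t : ℝ, v t ≠ 0)
    (heq : ∀ t : ℝ,
      iteratedDeriv 4 v t + (-(((n:ℝ)^2 - 4*(n:ℝ) + 8) / 2)) * iteratedDeriv 2 v t
        + ((n:ℝ)^2 * ((n:ℝ) - 4)^2 / 16) * v t = v t ^ (((n:ℝ) + 4) / ((n:ℝ) - 4))) :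
    ∀ t : ℝ, 0 < v t := by
  obtain ⟨T, hT, hvT⟩ := hper
  obtain ⟨s, hs⟩ := hne
  have hn' : (5 : ℝ) ≤ n := by exact_mod_cast hn
  have hd : ∀ k : ℕ, k < 4 → ∀ t, HasDerivAt (iteratedDeriv k v) (iteratedDeriv (k + 1) v t) t :=
    fun k hk t => by
      rw [iteratedDeriv_succ]
      exact (hreg.differentiable_iteratedDeriv k (by exact_mod_cast hk) t).hasDerivAt
  have hd0 : ∀ t, HasDerivAt v (iteratedDeriv 1 v t) t := by simpa using hd 0 (by norm_num)
  set β : ℝ := ((n : ℝ) - 4) / 2 with hβ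
  have hw : ∀ t, iteratedDeriv 2 v t - β ^ 2 * v t ≤ 0 := by
    refine Function.Periodic.nonpos_of_sq_mul_le_deriv2 (α := (n : ℝ) / 2)
      (w' := fun t => iteratedDeriv 3 v t - β ^ 2 * iteratedDeriv 1 v t)
      (w'' := fun t => iteratedDeriv 4 v t - β ^ 2 * iteratedDeriv 2 v t) (by linarith) hT
      (fun t => by simp only [hvT t, hvT.iteratedDeriv 2 t])
      (fun t => by simp only [hvT.iteratedDeriv 1 t, hvT.iteratedDeriv 3 t])
      (fun t => (hd 2 (by norm_num) t).sub ((hd0 t).const_mul _))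
      (fun t => (hd 3 (by norm_num) t).sub ((hd 1 (by norm_num) t).const_mul _)) fun t => ?_
    have hf := Real.rpow_nonneg (hnonneg t) (((n : ℝ) + 4) / ((n : ℝ) - 4))
    rw [← heq t] at hf
    rw [hβ]
    linear_combination hf
  intro t
  refine (hnonneg t).lt_of_ne' fun ht => hs ?_
  have ht' : iteratedDeriv 1 v t = 0 :=
    IsLocalMin.hasDerivAt_eq_zero (.of_forall fun x => ht.trans_le (hnonneg x)) (hd0 t)
  obtain ⟨r, hr, hrs⟩ := hvT.exists_mem_Ico hT s t
  rw [hrs]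
  exact le_antisymm (nonpos_of_deriv2_le_sq_mul hd0 (hd 1 (by norm_num))
    (fun x => sub_nonpos.1 (hw x)) ht ht' hr.1) (hnonneg r)
end

section
/- Let n ≥ 5, let v ∈ C⁴(ℝ) be a nonnegative, not identically zero, periodic solution of equation (∗), and define u(r) = r^{-(n-4)/2} v(log r) for r > 0. Then the radial Laplacian Δu(r) := u''(r) + ((n-1)/r) u'(r) satisfies: (i) r ↦ Δu(r) is strictly increasing on (0,∞); (ii) Δu(r) → 0 as r → +∞; and consequently (iii) Δu(r) < 0 for all r > 0. -/
open Set Filter Topology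

/-- Differentiating `r ^ a * F (log r)` lowers the power by one and replaces `F` by
`F' + a F`. -/
theorem hasDerivAt_rpow_mul_comp_log {F : ℝ → ℝ} {F' a r : ℝ} (hr : 0 < r)
    (hF : HasDerivAt F F' (Real.log r)) :
    HasDerivAt (fun x => x ^ a * F (Real.log x))
      (r ^ (a - 1) * (F' + a * F (Real.log r))) r := by
  have h1 := Real.hasDerivAt_rpow_const (x := r) (p := a) (Or.inl hr.ne')
  have h2 := hF.comp r (Real.hasDerivAt_log hr.ne')
  refine (h1.mul h2).congr_deriv ?_
  have h3 : r ^ a = r ^ (a - 1) * r := by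
    rw [← Real.rpow_add_one hr.ne', sub_add_cancel]
  simp only [Function.comp_apply]
  rw [h3]
  field_simp
  ring

/-- The derivative of a periodic function is periodic. -/
theorem Function.Periodic.of_hasDerivAt {f f' : ℝ → ℝ} {T : ℝ} (hf : Function.Periodic f T)
    (hd : ∀ t, HasDerivAt f (f' t) t) : Function.Periodic f' T := by
  intro t
  have h := (hd (t + T)).comp_add_const t T
  rw [show (fun x => f (x + T)) = f from funext hf] at h
  exact h.unique (hd t)

/-- A continuous periodic real function is bounded in absolute value. -/
theorem Function.Periodic.exists_abs_le {f : ℝ → ℝ} {T : ℝ} (hf : Function.Periodic f T)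
    (hT : 0 < T) (hc : Continuous f) : ∃ C, ∀ t, |f t| ≤ C := by
  obtain ⟨C, hC⟩ := (hf.isBounded_of_continuous hT.ne' hc).exists_norm_le
  exact ⟨C, fun t => hC _ (mem_range_self t)⟩

/-- A periodic `z` with `z' + m z ≥ 0`, not identically zero, is positive when `m > 0`. -/
theorem Function.Periodic.pos_of_deriv_add_mul_nonneg {z z' : ℝ → ℝ} {T m : ℝ}
    (hz : Function.Periodic z T) (hT : 0 < T) (hm : 0 < m)
    (hd : ∀ t, HasDerivAt z (z' t) t) (hnonneg : ∀ t, 0 ≤ z' t + m * z t)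
    (hne : ∃ t, z' t + m * z t ≠ 0) (t : ℝ) : 0 < z t := by
  have hG : ∀ s, HasDerivAt (fun s => Real.exp (m * s) * z s)
      (Real.exp (m * s) * (z' s + m * z s)) s := by
    intro s
    have h := (((hasDerivAt_id s).const_mul m).exp).mul (hd s)
    refine h.congr_deriv ?_
    simp only [id]
    ring
  have hmono : Monotone fun s => Real.exp (m * s) * z s :=
    monotone_of_hasDerivAt_nonneg hG fun s => mul_nonneg (Real.exp_pos _).le (hnonneg s)
  obtain ⟨C, hC⟩ := hz.exists_abs_le hT
    (continuous_iff_continuousAt.2 fun s => (hd s).continuousAt)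
  have hexp : Tendsto (fun s => Real.exp (m * s)) atBot (𝓝 0) :=
    Real.tendsto_exp_atBot.comp (tendsto_id.const_mul_atBot hm)
  have hlim : Tendsto (fun s => Real.exp (m * s) * z s) atBot (𝓝 0) :=
    hexp.zero_mul_isBoundedUnder_le (isBoundedUnder_of ⟨C, hC⟩)
  have hGnonneg : ∀ s, 0 ≤ Real.exp (m * s) * z s := fun s => hmono.le_of_tendsto hlim s
  have hznonneg : ∀ s, 0 ≤ z s := fun s =>
    nonneg_of_mul_nonneg_right (hGnonneg s) (Real.exp_pos _)
  refine (hznonneg t).lt_of_ne' fun hzt => ?_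
  have hleft : ∀ s ≤ t, z s = 0 := by
    intro s hs
    have h : Real.exp (m * s) * z s ≤ Real.exp (m * t) * z t := hmono hs
    rw [hzt, mul_zero] at h
    exact (mul_eq_zero.1 (le_antisymm h (hGnonneg s))).resolve_left (Real.exp_pos _).ne'
  have hzero : ∀ s, z s = 0 := by
    intro s
    obtain ⟨k, hk⟩ := exists_nat_ge ((s - t) / T)
    rw [div_le_iff₀ hT] at hk
    rw [← hz.sub_nat_mul_eq k]
    exact hleft _ (by linarith)
  obtain ⟨s, hs⟩ := hne
  have hdz : z' s = 0 := by
    have h := hd s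
    rw [show z = fun _ => 0 from funext hzero] at h
    exact h.unique (hasDerivAt_const s 0)
  exact hs (by rw [hdz, hzero, mul_zero, add_zero])

/-- For `n ≥ 5` and a nonnegative, not identically zero, periodic `C⁴`
solution `v` of `v'''' + K₂ v'' + K₀ v = v^((n+4)/(n-4))`, the radial Laplacian
`Δu(r) = u''(r) + ((n-1)/r) u'(r)` of `u(r) = r^(-(n-4)/2) v(log r)` is strictly
increasing on `(0,∞)`, tends to `0` as `r → +∞`, and hence is negative on `(0,∞)`. -/
theorem radial_laplacian_negative (n : ℕ) (hn : 5 ≤ n) (v : ℝ → ℝ)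
    (hreg : ContDiff ℝ 4 v) (hnonneg : ∀ t : ℝ, 0 ≤ v t)
    (hper : ∃ T : ℝ, 0 < T ∧ Function.Periodic v T)
    (hne : ∃ t : ℝ, v t ≠ 0)
    (heq : ∀ t : ℝ,
      iteratedDeriv 4 v t + (-(((n:ℝ)^2 - 4*(n:ℝ) + 8) / 2)) * iteratedDeriv 2 v t
        + ((n:ℝ)^2 * ((n:ℝ) - 4)^2 / 16) * v t = v t ^ (((n:ℝ) + 4) / ((n:ℝ) - 4)))
    (u : ℝ → ℝ)
    (hu : ∀ r : ℝ, u r = r ^ (-(((n:ℝ) - 4) / 2)) * v (Real.log r)) :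
    StrictMonoOn (fun r => iteratedDeriv 2 u r + (((n:ℝ) - 1) / r) * deriv u r)
      (Set.Ioi (0:ℝ)) ∧
    Filter.Tendsto (fun r => iteratedDeriv 2 u r + (((n:ℝ) - 1) / r) * deriv u r)
      Filter.atTop (nhds 0) ∧
    ∀ r : ℝ, 0 < r → iteratedDeriv 2 u r + (((n:ℝ) - 1) / r) * deriv u r < 0 := by
  obtain ⟨T, hT, hper⟩ := hper
  obtain ⟨t₀, ht₀⟩ := hne
  have hn5 : (5 : ℝ) ≤ n := by exact_mod_cast hn
  obtain ⟨m, hm⟩ : ∃ m : ℝ, m = ((n : ℝ) - 4) / 2 := ⟨_, rfl⟩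
  have hnm : (n : ℝ) = 2 * m + 4 := by linarith
  have hm0 : 0 < m := by linarith
  have hd : ∀ k < 4, ∀ t, HasDerivAt (iteratedDeriv k v) (iteratedDeriv (k + 1) v t) t := by
    intro k hk t
    rw [iteratedDeriv_succ]
    exact (hreg.differentiable_iteratedDeriv k (by exact_mod_cast hk) t).hasDerivAt
  have hd0 : ∀ t, HasDerivAt v (iteratedDeriv 1 v t) t := by
    simpa using hd 0 (by norm_num)
  have hd1 : ∀ t, HasDerivAt (iteratedDeriv 1 v) (iteratedDeriv 2 v t) t :=
    hd 1 (by norm_num)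
  have hd2 : ∀ t, HasDerivAt (iteratedDeriv 2 v) (iteratedDeriv 3 v t) t :=
    hd 2 (by norm_num)
  have hd3 : ∀ t, HasDerivAt (iteratedDeriv 3 v) (iteratedDeriv 4 v t) t :=
    hd 3 (by norm_num)
  have hp1 := hper.of_hasDerivAt hd0
  have hp2 := hp1.of_hasDerivAt hd1
  have hp3 := hp2.of_hasDerivAt hd2
  -- `Δu(r) = r ^ (-m - 2) * w (log r)`; its derivative is
  -- `r ^ (-m - 3) * (w' - (m + 2) * w) (log r)`
  set w : ℝ → ℝ := fun t => iteratedDeriv 2 v t + 2 * iteratedDeriv 1 v t - m * (m + 2) * v t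
    with hw
  set w' : ℝ → ℝ := fun t =>
    iteratedDeriv 3 v t + 2 * iteratedDeriv 2 v t - m * (m + 2) * iteratedDeriv 1 v t with hw'
  set w'' : ℝ → ℝ := fun t =>
    iteratedDeriv 4 v t + 2 * iteratedDeriv 3 v t - m * (m + 2) * iteratedDeriv 2 v t with hw''
  have hdw : ∀ t, HasDerivAt w (w' t) t := fun t =>
    ((hd2 t).add ((hd1 t).const_mul 2)).sub ((hd0 t).const_mul _)
  have hdw' : ∀ t, HasDerivAt w' (w'' t) t := fun t =>
    ((hd3 t).add ((hd2 t).const_mul 2)).sub ((hd1 t).const_mul _)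
  have hpw : Function.Periodic w T := fun t => by simp only [hw, hper t, hp1 t, hp2 t]
  have hpw' : Function.Periodic w' T := hpw.of_hasDerivAt hdw
  have hode : ∀ t, (w'' t - (m + 2) * w' t) + m * (w' t - (m + 2) * w t)
      = v t ^ (((n:ℝ) + 4) / ((n:ℝ) - 4)) := by
    intro t
    rw [← heq t, hnm]
    simp only [hw, hw', hw'']
    ring
  have hz : ∀ t, 0 < w' t - (m + 2) * w t := by
    refine Function.Periodic.pos_of_deriv_add_mul_nonneg (T := T) (m := m)
      (z' := fun t => w'' t - (m + 2) * w' t)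
      (fun t => by simp only [hpw t, hpw' t]) hT hm0
      (fun t => (hdw' t).sub ((hdw t).const_mul _)) (fun t => ?_) ⟨t₀, ?_⟩
    · rw [hode]
      exact Real.rpow_nonneg (hnonneg t) _
    · rw [hode]
      exact (Real.rpow_pos_of_pos ((hnonneg t₀).lt_of_ne' ht₀) _).ne'
  have hu' : u = fun r => r ^ (-m) * v (Real.log r) := by
    funext r
    rw [hu, hm]
  have hdu : ∀ r, 0 < r →
      deriv u r = r ^ (-m - 1) * (iteratedDeriv 1 v (Real.log r) + -m * v (Real.log r)) := by
    intro r hr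
    rw [hu']
    exact (hasDerivAt_rpow_mul_comp_log hr (hd0 _)).deriv
  have hddu : ∀ r, 0 < r → iteratedDeriv 2 u r = r ^ (-m - 1 - 1) *
      ((iteratedDeriv 2 v (Real.log r) + -m * iteratedDeriv 1 v (Real.log r)) +
        (-m - 1) * (iteratedDeriv 1 v (Real.log r) + -m * v (Real.log r))) := by
    intro r hr
    rw [iteratedDeriv_succ, iteratedDeriv_one]
    have hev : deriv u =ᶠ[𝓝 r] fun r =>
        r ^ (-m - 1) * (iteratedDeriv 1 v (Real.log r) + -m * v (Real.log r)) := by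
      filter_upwards [Ioi_mem_nhds hr] with x hx using hdu x hx
    rw [hev.deriv_eq]
    exact (hasDerivAt_rpow_mul_comp_log
      (F := fun t => iteratedDeriv 1 v t + -m * v t) hr
      ((hd1 _).add ((hd0 _).const_mul _))).deriv
  have hlap : ∀ r, 0 < r → iteratedDeriv 2 u r + (((n:ℝ) - 1) / r) * deriv u r
      = r ^ (-m - 2) * w (Real.log r) := by
    intro r hr
    have hpow : r ^ (-m - 1) = r ^ (-m - 2) * r := by
      rw [← Real.rpow_add_one hr.ne']
      ring_nf
    rw [hddu r hr, hdu r hr, hpow, hnm, show -m - 1 - 1 = -m - 2 by ring]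
    simp only [hw]
    field_simp
    ring
  have hmono : StrictMonoOn (fun r => r ^ (-m - 2) * w (Real.log r)) (Ioi (0 : ℝ)) := by
    have hder : ∀ r : ℝ, 0 < r → HasDerivAt (fun r => r ^ (-m - 2) * w (Real.log r))
        (r ^ (-m - 2 - 1) * (w' (Real.log r) + (-m - 2) * w (Real.log r))) r :=
      fun r hr => hasDerivAt_rpow_mul_comp_log hr (hdw _)
    refine strictMonoOn_of_deriv_pos (convex_Ioi 0)
      (fun r hr => (hder r hr).continuousAt.continuousWithinAt) fun r hr => ?_
    rw [interior_Ioi] at hr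
    rw [(hder r hr).deriv]
    exact mul_pos (Real.rpow_pos_of_pos hr _) (by linarith [hz (Real.log r)])
  have hlim : Tendsto (fun r => r ^ (-m - 2) * w (Real.log r)) atTop (𝓝 0) := by
    obtain ⟨C, hC⟩ := hpw.exists_abs_le hT
      (continuous_iff_continuousAt.2 fun s => (hdw s).continuousAt)
    have hpow : Tendsto (fun r : ℝ => r ^ (-m - 2)) atTop (𝓝 0) := by
      rw [show -m - 2 = -(m + 2) by ring]
      exact tendsto_rpow_neg_atTop (by linarith)
    exact hpow.zero_mul_isBoundedUnder_le (isBoundedUnder_of ⟨C, fun r => hC (Real.log r)⟩)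
  refine ⟨hmono.congr fun r hr => (hlap r hr).symm, hlim.congr' ?_, fun r hr => ?_⟩
  · filter_upwards [Ioi_mem_atTop 0] with r hr using (hlap r hr).symm
  · rw [hlap r hr]
    have hr1 : r < r + 1 := by linarith
    refine (hmono hr (hr.trans hr1) hr1).trans_le (ge_of_tendsto hlim ?_)
    filter_upwards [Ici_mem_atTop (r + 1)] with s hs
    exact hmono.monotoneOn (hr.trans hr1) ((hr.trans hr1).trans_le hs) hs
end

section
/- Let n ≥ 5 and let v ∈ C⁴(ℝ) be a positive periodic solution of equation (∗) with v(t) ≤ L := (n³(n-4)/16)^{(n-4)/8} for all t ∈ ℝ. Then for all t ∈ ℝ, v''(t) + 2v'(t) - (n(n-4)/4) v(t) + √((n-4)/n) · v(t)^{n/(n-4)} ≤ 0. Equivalently, the radial function u(r) = r^{-(n-4)/2} v(log r) satisfies -(u''(r) + ((n-1)/r) u'(r)) ≥ √((n-4)/n) · u(r)^{n/(n-4)} for all r > 0. -/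
/-- A weak maximum principle: a periodic function with `φ'' + b φ' ≥ c φ`, `c > 0`, is nonpositive. -/
theorem Function.Periodic.nonpos_of_mul_le_deriv {φ φ₁ φ₂ c : ℝ → ℝ} {b T : ℝ}
    (hT : 0 < T) (hφ : Function.Periodic φ T)
    (h₁ : ∀ t, HasDerivAt φ (φ₁ t) t) (h₂ : ∀ t, HasDerivAt φ₁ (φ₂ t) t)
    (hc : ∀ t, 0 < c t) (hle : ∀ t, c t * φ t ≤ φ₂ t + b * φ₁ t) (t : ℝ) : φ t ≤ 0 := by
  have hcont : Continuous φ := continuous_iff_continuousAt.2 fun t => (h₁ t).continuousAt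
  obtain ⟨s, -, hs⟩ := isCompact_Icc.exists_isMaxOn (Set.nonempty_Icc.2 hT.le)
    (hcont.continuousOn (s := Set.Icc 0 T))
  have hmax : ∀ x, φ x ≤ φ s := fun x => by
    obtain ⟨y, hy, hxy⟩ := hφ.exists_mem_Ico₀ hT x
    rw [hxy]
    exact hs (Set.Ico_subset_Icc_self hy)
  refine (hmax t).trans ?_
  by_contra! hs_pos
  have hd : deriv φ = φ₁ := funext fun t => (h₁ t).deriv
  have hd₂ : deriv φ₁ = φ₂ := funext fun t => (h₂ t).deriv
  have hcrit : φ₁ s = 0 :=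
    IsLocalMax.hasDerivAt_eq_zero (Filter.Eventually.of_forall hmax) (h₁ s)
  have hconv : 0 < φ₂ s := by
    have := hle s
    rw [hcrit, mul_zero, add_zero] at this
    exact (mul_pos (hc s) hs_pos).trans_le this
  have hmin : IsLocalMin φ s :=
    isLocalMin_of_deriv_deriv_pos (by rwa [hd, hd₂]) (by rwa [hd]) hcont.continuousAt
  have hconst : φ =ᶠ[nhds s] fun _ => φ s := hmin.mono fun x hx => le_antisymm (hmax x) hx
  have hzero : φ₂ s = 0 := by
    have := hconst.deriv.deriv_eq
    simpa [hd, hd₂] using this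
  exact hconv.ne' hzero

theorem Function.Periodic.deriv_periodic {f : ℝ → ℝ} {T : ℝ} (hf : Function.Periodic f T) :
    Function.Periodic (deriv f) T := fun t => by
  rw [← deriv_comp_add_const, hf.funext]

/-- If `v` is a positive periodic solution of the fourth-order Emden–Fowler equation in dimension
`N`, then `w = v'' + 2 v' - (N (N - 4) / 4) v` satisfies `w ≤ -√((N - 4) / N) v ^ (N / (N - 4))`. -/
theorem emdenFowler_laplacian_le {N T : ℝ} (hN : 4 < N) {v v₁ v₂ v₃ v₄ : ℝ → ℝ}
    (h₁ : ∀ t, HasDerivAt v (v₁ t) t) (h₂ : ∀ t, HasDerivAt v₁ (v₂ t) t)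
    (h₃ : ∀ t, HasDerivAt v₂ (v₃ t) t) (h₄ : ∀ t, HasDerivAt v₃ (v₄ t) t)
    (hpos : ∀ t, 0 < v t) (hT : 0 < T) (hper : Function.Periodic v T)
    (heq : ∀ t, v₄ t + (-((N ^ 2 - 4 * N + 8) / 2)) * v₂ t + (N ^ 2 * (N - 4) ^ 2 / 16) * v t
      = v t ^ ((N + 4) / (N - 4))) (t : ℝ) :
    v₂ t + 2 * v₁ t - (N * (N - 4) / 4) * v t
      + Real.sqrt ((N - 4) / N) * v t ^ (N / (N - 4)) ≤ 0 := by
  have hN₀ : 0 < N := by linarith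
  have hN₄ : 0 < N - 4 := by linarith
  set q := N / (N - 4) with hq
  set c := Real.sqrt ((N - 4) / N) with hc
  have hc₀ : 0 ≤ c := Real.sqrt_nonneg _
  have hcc : c ^ 2 = (N - 4) / N := Real.sq_sqrt (by positivity)
  have hq₀ : 0 < q := by positivity
  have hper₁ : Function.Periodic v₁ T := by
    have := hper.deriv_periodic
    rwa [funext fun t => (h₁ t).deriv] at this
  have hper₂ : Function.Periodic v₂ T := by
    have := hper₁.deriv_periodic
    rwa [funext fun t => (h₂ t).deriv] at this
  have hpow (p : ℝ) (t : ℝ) : HasDerivAt (fun t => v t ^ p) (v₁ t * p * v t ^ (p - 1)) t :=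
    (h₁ t).rpow_const (Or.inl (hpos t).ne')
  refine Function.Periodic.nonpos_of_mul_le_deriv (b := -2)
    (φ := fun t => v₂ t + 2 * v₁ t - (N * (N - 4) / 4) * v t + c * v t ^ q)
    (φ₁ := fun t => v₃ t + 2 * v₂ t - (N * (N - 4) / 4) * v₁ t + c * (v₁ t * q * v t ^ (q - 1)))
    (φ₂ := fun t => v₄ t + 2 * v₃ t - (N * (N - 4) / 4) * v₂ t
      + c * (v₂ t * q * v t ^ (q - 1) + v₁ t * q * (v₁ t * (q - 1) * v t ^ (q - 1 - 1))))
    (c := fun t => N * (N - 4) / 4 + c * q * v t ^ (q - 1))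
    hT ?_ ?_ ?_ ?_ ?_ t
  · intro t
    simp only [hper t, hper₁ t, hper₂ t]
  · intro t
    exact (((h₃ t).add ((h₂ t).const_mul 2)).sub ((h₁ t).const_mul _)).add
      ((hpow q t).const_mul c)
  · intro t
    exact (((h₄ t).add ((h₃ t).const_mul 2)).sub ((h₂ t).const_mul _)).add
      ((((h₂ t).mul_const q).mul (hpow (q - 1) t)).const_mul c)
  · intro t
    have := hpos t
    positivity
  · intro t
    have hv := hpos t
    set z := v t ^ (q - 1 - 1) with hz
    have hz₀ : 0 < z := by positivity
    have e₁ : v t ^ (q - 1) = z * v t := by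
      rw [hz, ← Real.rpow_add_one hv.ne', sub_add_cancel]
    have e₂ : v t ^ q = z * v t ^ 2 := by
      rw [hz, ← Real.rpow_natCast, ← Real.rpow_add hv]
      congr 1
      push_cast
      ring
    have e₃ : v t ^ ((N + 4) / (N - 4)) = z ^ 2 * v t ^ 3 := by
      rw [hz, ← Real.rpow_natCast, ← Real.rpow_natCast, ← Real.rpow_mul hv.le, ← Real.rpow_add hv]
      congr 1
      rw [hq]
      push_cast
      field_simp
      ring
    have he := heq t
    rw [e₃] at he
    simp only [e₁, e₂]
    have hcq : c ^ 2 * q = 1 := by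
      rw [hcc, hq]
      field_simp
    have hsq : 0 ≤ c * z * (N * (v t - 2 * v₁ t / (N - 4)) ^ 2) := by positivity
    have hform : N * (v t - 2 * v₁ t / (N - 4)) ^ 2
        = N * (N - 4) / 4 * (q - 1) * v t ^ 2 - 4 * q * v t * v₁ t + q * (q - 1) * v₁ t ^ 2 := by
      rw [hq]
      field_simp
      ring
    rw [hform] at hsq
    linear_combination hsq - he + z ^ 2 * v t ^ 3 * hcq

/-- The radial Laplacian in dimension `N` in Emden–Fowler coordinates. -/
theorem radial_laplacian_emdenFowler {N : ℝ} {u v v₁ v₂ : ℝ → ℝ}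
    (h₁ : ∀ t, HasDerivAt v (v₁ t) t) (h₂ : ∀ t, HasDerivAt v₁ (v₂ t) t)
    (hu : ∀ r, u r = r ^ (-((N - 4) / 2)) * v (Real.log r)) {r : ℝ} (hr : 0 < r) :
    iteratedDeriv 2 u r + (N - 1) / r * deriv u r = r ^ (-(N / 2)) *
      (v₂ (Real.log r) + 2 * v₁ (Real.log r) - N * (N - 4) / 4 * v (Real.log r)) := by
  have key {f f₁ : ℝ → ℝ} (hf : ∀ t, HasDerivAt f (f₁ t) t) (p : ℝ) {r : ℝ} (hr : 0 < r) :
      HasDerivAt (fun r => r ^ p * f (Real.log r))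
        (r ^ (p - 1) * (f₁ (Real.log r) + p * f (Real.log r))) r := by
    have := (Real.hasDerivAt_rpow_const (p := p) (Or.inl hr.ne')).mul
      ((hf (Real.log r)).comp r (Real.hasDerivAt_log hr.ne'))
    refine this.congr_deriv ?_
    rw [Real.rpow_sub_one hr.ne']
    simp only [Function.comp_apply]
    field_simp
    ring
  set p := -((N - 4) / 2) with hp
  have hd {r : ℝ} (hr : 0 < r) :
      deriv u r = r ^ (p - 1) * (v₁ (Real.log r) + p * v (Real.log r)) := by
    rw [funext hu]
    exact (key h₁ p hr).deriv
  have hd₂ : iteratedDeriv 2 u r = r ^ (p - 1 - 1) * ((v₂ (Real.log r) + p * v₁ (Real.log r))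
      + (p - 1) * (v₁ (Real.log r) + p * v (Real.log r))) := by
    rw [iteratedDeriv_succ, iteratedDeriv_one]
    have hev : deriv u =ᶠ[nhds r]
        fun r => r ^ (p - 1) * (v₁ (Real.log r) + p * v (Real.log r)) :=
      (eventually_gt_nhds hr).mono fun _ => hd
    rw [hev.deriv_eq]
    exact (key (f := fun t => v₁ t + p * v t) (fun t => (h₂ t).add ((h₁ t).const_mul p))
      (p - 1) hr).deriv
  rw [hd₂, hd hr, show -(N / 2) = p - 1 - 1 by rw [hp]; ring, Real.rpow_sub_one hr.ne' (p - 1),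
    hp]
  field_simp
  ring

/-- For `n ≥ 5` and a positive periodic `C⁴` solution `v` of
`v'''' + K₂ v'' + K₀ v = v^((n+4)/(n-4))` with `v ≤ L = (n³(n-4)/16)^((n-4)/8)`,
one has `v'' + 2v' - (n(n-4)/4) v + √((n-4)/n) v^(n/(n-4)) ≤ 0` on `ℝ`;
equivalently, `u(r) = r^(-(n-4)/2) v(log r)` satisfies
`-Δu ≥ √((n-4)/n) u^(n/(n-4))` on `(0,∞)`. -/
theorem first_lower_bound_laplacian (n : ℕ) (hn : 5 ≤ n) (v : ℝ → ℝ)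
    (hreg : ContDiff ℝ 4 v) (hpos : ∀ t : ℝ, 0 < v t)
    (hper : ∃ T : ℝ, 0 < T ∧ Function.Periodic v T)
    (hbound : ∀ t : ℝ, v t ≤ ((n:ℝ)^3 * ((n:ℝ) - 4) / 16) ^ (((n:ℝ) - 4) / 8))
    (heq : ∀ t : ℝ,
      iteratedDeriv 4 v t + (-(((n:ℝ)^2 - 4*(n:ℝ) + 8) / 2)) * iteratedDeriv 2 v t
        + ((n:ℝ)^2 * ((n:ℝ) - 4)^2 / 16) * v t = v t ^ (((n:ℝ) + 4) / ((n:ℝ) - 4)))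
    (u : ℝ → ℝ)
    (hu : ∀ r : ℝ, u r = r ^ (-(((n:ℝ) - 4) / 2)) * v (Real.log r)) :
    (∀ t : ℝ,
      iteratedDeriv 2 v t + 2 * deriv v t - ((n:ℝ) * ((n:ℝ) - 4) / 4) * v t
        + Real.sqrt (((n:ℝ) - 4) / (n:ℝ)) * v t ^ ((n:ℝ) / ((n:ℝ) - 4)) ≤ 0) ∧
    (∀ r : ℝ, 0 < r →
      Real.sqrt (((n:ℝ) - 4) / (n:ℝ)) * u r ^ ((n:ℝ) / ((n:ℝ) - 4))
        ≤ -(iteratedDeriv 2 u r + (((n:ℝ) - 1) / r) * deriv u r)) := by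
  have hN : (4 : ℝ) < n := by exact_mod_cast hn
  have hd (k : ℕ) (hk : k < 4) (t : ℝ) :
      HasDerivAt (iteratedDeriv k v) (iteratedDeriv (k + 1) v t) t := by
    rw [iteratedDeriv_succ]
    exact (hreg.differentiable_iteratedDeriv k (by exact_mod_cast hk) t).hasDerivAt
  have h₁ (t : ℝ) : HasDerivAt v (deriv v t) t := by
    simpa using hd 0 (by norm_num) t
  have h₂ (t : ℝ) : HasDerivAt (deriv v) (iteratedDeriv 2 v t) t := by
    simpa using hd 1 (by norm_num) t
  obtain ⟨T, hT, hvT⟩ := hper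
  have hmain := emdenFowler_laplacian_le hN h₁ h₂ (hd 2 (by norm_num)) (hd 3 (by norm_num))
    hpos hT hvT heq
  refine ⟨hmain, fun r hr => ?_⟩
  rw [radial_laplacian_emdenFowler h₁ h₂ hu hr, hu r,
    Real.mul_rpow (by positivity) (hpos _).le, ← Real.rpow_mul hr.le,
    show -(((n : ℝ) - 4) / 2) * ((n : ℝ) / ((n : ℝ) - 4)) = -((n : ℝ) / 2) by
      have : (n : ℝ) - 4 ≠ 0 := by linarith
      field_simp]
  linear_combination r ^ (-((n : ℝ) / 2)) * hmain (Real.log r)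
end

section
/- Let n ≥ 5 and let v ∈ C⁴(ℝ) be a positive solution of equation (∗). Define ṽ(t) = v''(t) + 2v'(t) - (n(n-4)/4) v(t) + √((n-4)/n) · v(t)^{n/(n-4)}. Then for all t ∈ ℝ the identity ṽ''(t) - 2ṽ'(t) - [ n(n-4)/4 + (n/(n-4))·√((n-4)/n) · v(t)^{4/(n-4)} ] · ṽ(t) = n·√((n-4)/n) · v(t)^{(8-n)/(n-4)} · ( v(t) - (2/(n-4)) v'(t) )² holds; in particular the left-hand side is nonnegative for all t. -/
/-- For `n ≥ 5` and a positive `C⁴` solution `v` of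
`v'''' + K₂ v'' + K₀ v = v^((n+4)/(n-4))`, the function
`ṽ = v'' + 2v' - (n(n-4)/4) v + √((n-4)/n) v^(n/(n-4))` satisfies the identity
`ṽ'' - 2ṽ' - [n(n-4)/4 + (n/(n-4))√((n-4)/n) v^(4/(n-4))] ṽ
  = n √((n-4)/n) v^((8-n)/(n-4)) (v - (2/(n-4)) v')²`,
whose right-hand side is nonnegative. -/
theorem tilde_v_identity (n : ℕ) (hn : 5 ≤ n) (v : ℝ → ℝ)
    (hreg : ContDiff ℝ 4 v) (hpos : ∀ t : ℝ, 0 < v t)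
    (heq : ∀ t : ℝ,
      iteratedDeriv 4 v t + (-(((n:ℝ)^2 - 4*(n:ℝ) + 8) / 2)) * iteratedDeriv 2 v t
        + ((n:ℝ)^2 * ((n:ℝ) - 4)^2 / 16) * v t = v t ^ (((n:ℝ) + 4) / ((n:ℝ) - 4)))
    (w : ℝ → ℝ)
    (hw : ∀ t : ℝ, w t = iteratedDeriv 2 v t + 2 * deriv v t
        - ((n:ℝ) * ((n:ℝ) - 4) / 4) * v t
        + Real.sqrt (((n:ℝ) - 4) / (n:ℝ)) * v t ^ ((n:ℝ) / ((n:ℝ) - 4))) :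
    ∀ t : ℝ,
      iteratedDeriv 2 w t - 2 * deriv w t
        - ((n:ℝ) * ((n:ℝ) - 4) / 4
            + ((n:ℝ) / ((n:ℝ) - 4)) * Real.sqrt (((n:ℝ) - 4) / (n:ℝ))
              * v t ^ ((4:ℝ) / ((n:ℝ) - 4))) * w t
      = (n:ℝ) * Real.sqrt (((n:ℝ) - 4) / (n:ℝ)) * v t ^ ((8 - (n:ℝ)) / ((n:ℝ) - 4))
          * (v t - (2 / ((n:ℝ) - 4)) * deriv v t)^2 ∧
      0 ≤ iteratedDeriv 2 w t - 2 * deriv w t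
        - ((n:ℝ) * ((n:ℝ) - 4) / 4
            + ((n:ℝ) / ((n:ℝ) - 4)) * Real.sqrt (((n:ℝ) - 4) / (n:ℝ))
              * v t ^ ((4:ℝ) / ((n:ℝ) - 4))) * w t := by
  intro t
  set N : ℝ := (n : ℝ) with hN
  have hN5 : (5 : ℝ) ≤ N := by rw [hN]; exact_mod_cast hn
  have hx : (0 : ℝ) < N - 4 := by linarith
  have hN0 : (0 : ℝ) < N := by linarith
  set c := Real.sqrt ((N - 4) / N) with hc
  have hc0 : 0 ≤ c := Real.sqrt_nonneg _
  have hcsq : c ^ 2 * (N / (N - 4)) = 1 := by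
    rw [hc, Real.sq_sqrt (by positivity)]
    field_simp
  have hd (k : ℕ) (hk : k < 4) (s : ℝ) :
      HasDerivAt (iteratedDeriv k v) (iteratedDeriv (k + 1) v s) s := by
    rw [iteratedDeriv_succ]
    exact (hreg.differentiable_iteratedDeriv k (by exact_mod_cast hk) s).hasDerivAt
  have hd0 (s : ℝ) : HasDerivAt v (deriv v s) s := by
    simpa using hd 0 (by norm_num) s
  have hd1 (s : ℝ) : HasDerivAt (deriv v) (iteratedDeriv 2 v s) s := by
    simpa [iteratedDeriv_one] using hd 1 (by norm_num) s
  have hw1 (s : ℝ) : HasDerivAt w (iteratedDeriv 3 v s + 2 * iteratedDeriv 2 v s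
      - (N * (N - 4) / 4) * deriv v s
      + c * (deriv v s * (N / (N - 4)) * v s ^ (N / (N - 4) - 1))) s := by
    rw [show w = _ from funext hw]
    exact (((hd 2 (by norm_num) s).add ((hd1 s).const_mul 2)).sub ((hd0 s).const_mul _)).add
      (((hd0 s).rpow_const (Or.inl (hpos s).ne')).const_mul c)
  have hw2 : HasDerivAt (deriv w) (iteratedDeriv 4 v t + 2 * iteratedDeriv 3 v t
      - (N * (N - 4) / 4) * iteratedDeriv 2 v t
      + c * (iteratedDeriv 2 v t * (N / (N - 4)) * v t ^ (N / (N - 4) - 1)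
        + deriv v t * (N / (N - 4))
          * (deriv v t * (N / (N - 4) - 1) * v t ^ (N / (N - 4) - 1 - 1)))) t := by
    rw [show deriv w = _ from funext fun s => (hw1 s).deriv]
    exact (((hd 3 (by norm_num) t).add ((hd 2 (by norm_num) t).const_mul 2)).sub
      ((hd1 t).const_mul _)).add
      ((((hd1 t).mul_const _).mul
        ((hd0 t).rpow_const (Or.inl (hpos t).ne'))).const_mul c)
  have hv := hpos t
  set P := v t ^ ((8 - N) / (N - 4)) with hP
  have e0 : v t ^ (N / (N - 4) - 1 - 1) = P := by
    rw [hP]; congr 1; field_simp; ring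
  have e1 : v t ^ (N / (N - 4) - 1) = P * v t := by
    rw [hP, ← Real.rpow_add_one hv.ne']; congr 1; field_simp; ring
  have e1' : v t ^ (4 / (N - 4)) = P * v t := by
    rw [hP, ← Real.rpow_add_one hv.ne']; congr 1; field_simp; ring
  have e2 : v t ^ (N / (N - 4)) = P * v t ^ 2 := by
    rw [hP, ← Real.rpow_natCast, ← Real.rpow_add hv]; congr 1; push_cast; field_simp; ring
  have e3 : v t ^ ((N + 4) / (N - 4)) = P ^ 2 * v t ^ 3 := by
    rw [hP, ← Real.rpow_natCast (v t) 3, ← Real.rpow_mul_natCast hv.le, ← Real.rpow_add hv]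
    congr 1; push_cast; field_simp; ring
  have E := heq t
  rw [e3] at E
  have key : iteratedDeriv 2 w t - 2 * deriv w t
        - (N * (N - 4) / 4 + (N / (N - 4)) * c * v t ^ ((4:ℝ) / (N - 4))) * w t
      = N * c * P * (v t - (2 / (N - 4)) * deriv v t)^2 := by
    rw [show iteratedDeriv 2 w t = deriv (deriv w) t by
      rw [iteratedDeriv_succ, iteratedDeriv_one], hw2.deriv, (hw1 t).deriv, hw t, e0, e1, e1', e2]
    obtain ⟨x, hxN⟩ : ∃ x, x = N - 4 := ⟨_, rfl⟩
    have hNx : N = x + 4 := by linarith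
    have hx0 : x ≠ 0 := by rw [hxN]; exact hx.ne'
    rw [← hxN] at hcsq E ⊢
    rw [hNx] at hcsq E ⊢
    linear_combination E - (P ^ 2 * v t ^ 3) * hcsq + c * P * (v t ^ 2 * (4 + 2 * x + x ^ 2 / 4)
      + deriv v t ^ 2 * (x * x⁻¹ + 4 * x⁻¹)) * mul_inv_cancel₀ hx0
  refine ⟨key, ?_⟩
  rw [key]
  positivity
end

section
/- Let n ≥ 5 and let v ∈ C⁴(ℝ) be a positive periodic solution of equation (∗) with v(t) ≤ L := (n³(n-4)/16)^{(n-4)/8} for all t ∈ ℝ, and define u(r) = r^{-(n-4)/2} v(log r) for r > 0. Then the pointwise inequality -(u''(r) + ((n-1)/r) u'(r)) ≥ √( n(n-4)/(n²-4) ) · u(r)^{n/(n-4)} + (2/(n-4)) · u'(r)²/u(r) holds for all r > 0; equivalently, the radial function u(x) = |x|^{-(n-4)/2} v(log|x|) on ℝⁿ \ {0} satisfies -Δu ≥ √(n(n-4)/(n²-4)) u^{n/(n-4)} + (2/(n-4)) |∇u|²/u on ℝⁿ \ {0}. -/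
/-- First and second order necessary conditions at a global minimum. -/
theorem necessary_conditions_of_forall_le {φ φ' : ℝ → ℝ} {c t₀ : ℝ}
    (h1 : ∀ t, HasDerivAt φ (φ' t) t) (h2 : HasDerivAt φ' c t₀) (hmin : ∀ t, φ t₀ ≤ φ t) :
    φ' t₀ = 0 ∧ 0 ≤ c := by
  have hlm : IsLocalMin φ t₀ := Filter.Eventually.of_forall hmin
  have hd : deriv φ = φ' := funext fun t => (h1 t).deriv
  have hz : φ' t₀ = 0 := by rw [← hd]; exact hlm.deriv_eq_zero
  refine ⟨hz, ?_⟩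
  by_contra! hc
  have hlM : IsLocalMax φ t₀ := isLocalMax_of_deriv_deriv_neg
    (by rw [hd, h2.deriv]; exact hc) (by rw [hd, hz]) (h1 t₀).continuousAt
  have hconst : φ =ᶠ[nhds t₀] fun _ => φ t₀ := by
    filter_upwards [hlm, hlM] with t ha hb
    exact le_antisymm hb ha
  have hconst' : φ' =ᶠ[nhds t₀] fun _ => 0 := by
    have := hconst.deriv
    rw [hd] at this
    simpa using this
  have := hconst'.deriv_eq
  rw [h2.deriv, deriv_const] at this
  exact hc.ne this

/-- The pointwise algebra behind the bound for the scalar curvature at its minimum: `x, y, z, s, f`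
stand for a positive function and its first four derivatives. -/
theorem curvature_algebra {a x y z s f Λ : ℝ} (ha : 0 < a) (hx : 0 < x)
    (h0 : (a * (a + 1) * x - z) * x - y ^ 2 / a - Λ * x ^ 2 = 0)
    (h1 : 2 * (a * (a + 1)) * x * y - (1 + 2 / a) * (y * z) - x * s
      - (2 + 2 / a) * Λ * x * y = 0)
    (h2 : 0 ≤ 2 * (a * (a + 1)) * (y ^ 2 + x * z) - (1 + 2 / a) * (z ^ 2 + y * s)
      - (y * s + x * f)
      - (2 + 2 / a) * Λ * ((1 + 2 / a) * y ^ 2 + x * z)) :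
    f - (2 * a ^ 2 + 4 * a + 4) * z + a ^ 2 * (a + 2) ^ 2 * x
      ≤ (a + 1) * (a + 3) / (a * (a + 2)) * Λ ^ 2 * x := by
  obtain ⟨e, rfl⟩ : ∃ e, y = x * e := ⟨y / x, by field_simp⟩
  have hz : z = x * (a * (a + 1) - e ^ 2 / a - Λ) := by
    apply mul_right_cancel₀ hx.ne'
    linear_combination -h0
  set ζ := a * (a + 1) - e ^ 2 / a - Λ with hζ
  subst hz
  have hs : s = x * (e * (2 * (a * (a + 1)) - (1 + 2 / a) * ζ - (2 + 2 / a) * Λ)) := by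
    apply mul_left_cancel₀ hx.ne'
    linear_combination -h1
  subst hs
  obtain ⟨g, rfl⟩ : ∃ g, f = x * g := ⟨f / x, by field_simp⟩
  have hg : 0 ≤ 2 * (a * (a + 1)) * (e ^ 2 + ζ)
      - (1 + 2 / a) * (ζ ^ 2
        + e * (e * (2 * (a * (a + 1)) - (1 + 2 / a) * ζ - (2 + 2 / a) * Λ)))
      - (e * (e * (2 * (a * (a + 1)) - (1 + 2 / a) * ζ - (2 + 2 / a) * Λ)) + g)
      - (2 + 2 / a) * Λ * ((1 + 2 / a) * e ^ 2 + ζ) := by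
    refine nonneg_of_mul_nonneg_right (a := x ^ 2) ?_ (by positivity)
    refine h2.trans_eq ?_
    ring
  have hsq : 0 ≤ (2 * a + 3) / (a * (a + 2)) * (Λ - a * (a + 2) + (a + 2) / a * e ^ 2) ^ 2 := by
    positivity
  have key : g - (2 * a ^ 2 + 4 * a + 4) * ζ + a ^ 2 * (a + 2) ^ 2
      ≤ (a + 1) * (a + 3) / (a * (a + 2)) * Λ ^ 2 := by
    have : (a + 1) * (a + 3) / (a * (a + 2)) * Λ ^ 2
        - (g - (2 * a ^ 2 + 4 * a + 4) * ζ + a ^ 2 * (a + 2) ^ 2)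
        = (2 * (a * (a + 1)) * (e ^ 2 + ζ)
      - (1 + 2 / a) * (ζ ^ 2
        + e * (e * (2 * (a * (a + 1)) - (1 + 2 / a) * ζ - (2 + 2 / a) * Λ)))
      - (e * (e * (2 * (a * (a + 1)) - (1 + 2 / a) * ζ - (2 + 2 / a) * Λ)) + g)
      - (2 + 2 / a) * Λ * ((1 + 2 / a) * e ^ 2 + ζ))
        + (2 * a + 3) / (a * (a + 2)) * (Λ - a * (a + 2) + (a + 2) / a * e ^ 2) ^ 2 := by
      rw [hζ]
      field_simp
      ring
    linarith
  nlinarith [mul_le_mul_of_nonneg_left key hx.le]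

/-- If the scalar curvature of `w` on the cylinder attains its minimum `lam` at `t₀`, then the
`Q`-curvature at `t₀` is bounded by a multiple of `lam ^ 2`. -/
theorem paneitz_le_at_min_curvature {a lam t₀ : ℝ} (ha : 0 < a) {w w₁ w₂ w₃ w₄ : ℝ → ℝ}
    (hw : ∀ t, HasDerivAt w (w₁ t) t) (hw₁ : ∀ t, HasDerivAt w₁ (w₂ t) t)
    (hw₂ : ∀ t, HasDerivAt w₂ (w₃ t) t) (hw₃ : ∀ t, HasDerivAt w₃ (w₄ t) t)
    (hpos : ∀ t, 0 < w t)
    (h0 : (a * (a + 1) * w t₀ - w₂ t₀) * w t₀ - w₁ t₀ ^ 2 / a = lam * w t₀ ^ (2 + 2 / a))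
    (hmin : ∀ t, lam * w t ^ (2 + 2 / a) ≤ (a * (a + 1) * w t - w₂ t) * w t - w₁ t ^ 2 / a) :
    w₄ t₀ - (2 * a ^ 2 + 4 * a + 4) * w₂ t₀ + a ^ 2 * (a + 2) ^ 2 * w t₀
      ≤ (a + 1) * (a + 3) / (a * (a + 2)) * (lam * w t₀ ^ (2 / a)) ^ 2 * w t₀ := by
  have hφ : ∀ t, HasDerivAt
      (fun t => (a * (a + 1) * w t - w₂ t) * w t - w₁ t ^ 2 / a - lam * w t ^ (2 + 2 / a))
      (2 * (a * (a + 1)) * w t * w₁ t - (1 + 2 / a) * (w₁ t * w₂ t) - w t * w₃ t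
        - (2 + 2 / a) * lam * (w t ^ (1 + 2 / a) * w₁ t)) t := by
    intro t
    refine HasDerivAt.congr_deriv ((((((hw t).const_mul (a * (a + 1))).sub (hw₂ t)).mul (hw t)).sub
      (((hw₁ t).pow 2).div_const a)).sub
      (((hw t).rpow_const (p := 2 + 2 / a) (Or.inl (hpos t).ne')).const_mul lam)) ?_
    rw [show 2 + 2 / a - 1 = 1 + 2 / a by ring]
    simp only [Pi.sub_apply]
    push_cast
    ring
  have hφ' : HasDerivAt
      (fun t => 2 * (a * (a + 1)) * w t * w₁ t - (1 + 2 / a) * (w₁ t * w₂ t) - w t * w₃ t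
        - (2 + 2 / a) * lam * (w t ^ (1 + 2 / a) * w₁ t))
      (2 * (a * (a + 1)) * (w₁ t₀ ^ 2 + w t₀ * w₂ t₀)
        - (1 + 2 / a) * (w₂ t₀ ^ 2 + w₁ t₀ * w₃ t₀) - (w₁ t₀ * w₃ t₀ + w t₀ * w₄ t₀)
        - (2 + 2 / a) * lam * ((1 + 2 / a) * w t₀ ^ (2 / a) * w₁ t₀ ^ 2
          + w t₀ ^ (1 + 2 / a) * w₂ t₀)) t₀ := by
    refine HasDerivAt.congr_deriv ((((((hw t₀).const_mul (2 * (a * (a + 1)))).mul (hw₁ t₀)).sub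
      (((hw₁ t₀).mul (hw₂ t₀)).const_mul (1 + 2 / a))).sub ((hw t₀).mul (hw₃ t₀))).sub
      ((((hw t₀).rpow_const (p := 1 + 2 / a) (Or.inl (hpos t₀).ne')).mul (hw₁ t₀)).const_mul
        ((2 + 2 / a) * lam))) ?_
    rw [show 1 + 2 / a - 1 = 2 / a by ring]
    ring
  obtain ⟨hfirst, hsecond⟩ := necessary_conditions_of_forall_le hφ hφ' (fun t => by
    have := hmin t
    linarith)
  have e1 : w t₀ ^ (1 + 2 / a) = w t₀ * w t₀ ^ (2 / a) := by
    rw [Real.rpow_add (hpos t₀), Real.rpow_one]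
  have e2 : w t₀ ^ (2 + 2 / a) = w t₀ ^ 2 * w t₀ ^ (2 / a) := by
    rw [Real.rpow_add (hpos t₀), Real.rpow_two]
  rw [e1] at hfirst hsecond
  rw [e2] at h0
  refine curvature_algebra (s := w₃ t₀) (y := w₁ t₀) ha (hpos t₀) ?_ ?_ ?_
  · linear_combination h0
  · linear_combination hfirst
  · refine hsecond.trans_eq ?_
    ring

/-- A periodic positive function with positive `Q`-curvature has positive scalar curvature.  The
proof is a continuity argument along the family `v + M`, `0 ≤ M`. -/
theorem scalar_curvature_pos {a T : ℝ} (ha : 1 / 2 ≤ a) (hT : 0 < T) {v v₁ v₂ v₃ v₄ : ℝ → ℝ}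
    (hv : ∀ t, HasDerivAt v (v₁ t) t) (hv₁ : ∀ t, HasDerivAt v₁ (v₂ t) t)
    (hv₂ : ∀ t, HasDerivAt v₂ (v₃ t) t) (hv₃ : ∀ t, HasDerivAt v₃ (v₄ t) t)
    (hpos : ∀ t, 0 < v t)
    (hp : Function.Periodic v T) (hp₁ : Function.Periodic v₁ T) (hp₂ : Function.Periodic v₂ T)
    (hQ : ∀ t, 0 < v₄ t - (2 * a ^ 2 + 4 * a + 4) * v₂ t + a ^ 2 * (a + 2) ^ 2 * v t) (t : ℝ) :
    0 < (a * (a + 1) * v t - v₂ t) * v t - v₁ t ^ 2 / a := by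
  have ha0 : 0 < a := by linarith
  have cv : Continuous v := continuous_iff_continuousAt.2 fun t => (hv t).continuousAt
  have cv₁ : Continuous v₁ := continuous_iff_continuousAt.2 fun t => (hv₁ t).continuousAt
  have cv₂ : Continuous v₂ := continuous_iff_continuousAt.2 fun t => (hv₂ t).continuousAt
  set g : ℝ → ℝ → ℝ := fun M t =>
    (a * (a + 1) * (v t + M) - v₂ t) * (v t + M) - v₁ t ^ 2 / a with hg
  have cg : Continuous fun p : ℝ × ℝ => g p.2 p.1 := by
    simp only [hg]
    fun_prop
  have hgp : ∀ M, Function.Periodic (g M) T := fun M t => by simp only [hg, hp t, hp₁ t, hp₂ t]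
  by_contra! hneg
  obtain ⟨t₁, ht₁, hgt₁⟩ := (hgp 0).exists_mem_Ico₀ hT t
  replace hneg : g 0 t₁ ≤ 0 := by
    rw [← hgt₁]
    simpa [hg] using hneg
  obtain ⟨C₁, hC₁⟩ := (isCompact_Icc (a := 0) (b := T)).exists_bound_of_continuousOn
    cv₂.continuousOn
  obtain ⟨C₂, hC₂⟩ := (isCompact_Icc (a := 0) (b := T)).exists_bound_of_continuousOn
    (f := fun t => v₁ t ^ 2 / a) (by fun_prop)
  obtain ⟨C, hC, hC1, hC2⟩ : ∃ C : ℝ, 1 ≤ C ∧ C₁ ≤ C ∧ C₂ ≤ C :=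
    ⟨max 1 (max C₁ C₂), le_max_left _ _, (le_max_left _ _).trans (le_max_right _ _),
      (le_max_right _ _).trans (le_max_right _ _)⟩
  have hlarge : ∀ M t, t ∈ Set.Icc 0 T → 4 * C ≤ M → 0 < g M t := by
    intro M t ht hM
    have b1 := (le_abs_self _).trans ((hC₁ t ht).trans hC1)
    have b2 := (le_abs_self _).trans ((hC₂ t ht).trans hC2)
    have hA : 3 / 4 ≤ a * (a + 1) := by nlinarith
    have hvM : 4 * C ≤ v t + M := by linarith [hpos t]
    have h3 : 2 * C ≤ a * (a + 1) * (v t + M) - v₂ t := by nlinarith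
    have h4 : 2 * C * (4 * C) ≤ (a * (a + 1) * (v t + M) - v₂ t) * (v t + M) :=
      mul_le_mul h3 hvM (by linarith) (by linarith)
    simp only [hg]
    nlinarith
  set K : Set (ℝ × ℝ) := (Set.Icc 0 T ×ˢ Set.Icc 0 (4 * C)) ∩ {p | g p.2 p.1 ≤ 0} with hK
  have hKc : IsCompact K :=
    (isCompact_Icc.prod isCompact_Icc).inter_right (isClosed_le cg continuous_const)
  have hKne : K.Nonempty :=
    ⟨(t₁, 0), ⟨⟨Set.Ico_subset_Icc_self ht₁, by simp; linarith⟩, hneg⟩⟩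
  obtain ⟨⟨t₀, M⟩, hmem, hmax⟩ := hKc.exists_isMaxOn hKne continuous_snd.continuousOn
  obtain ⟨⟨ht₀, hM0, hMC⟩, hg0⟩ := hmem
  simp only [Set.mem_ofPred_eq] at ht₀ hM0 hMC hg0
  have hnonneg : ∀ t, 0 ≤ g M t := by
    intro t
    obtain ⟨t', ht', htt'⟩ := (hgp M).exists_mem_Ico₀ hT t
    replace ht' := Set.Ico_subset_Icc_self ht'
    rw [htt']
    by_contra! hlt
    have hev : ∀ᶠ N in nhds M, g N t' < 0 :=
      (cg.comp (Continuous.prodMk_right t')).continuousAt.eventually_lt continuousAt_const hlt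
    obtain ⟨N, hN, hMN⟩ := ((hev.filter_mono nhdsWithin_le_nhds).and
      (self_mem_nhdsWithin (a := M) (s := Set.Ioi M))).exists
    have hMN' : M < N := hMN
    have hNC : N ≤ 4 * C := by
      by_contra! h
      exact (hlarge N t' ht' h.le).not_gt hN
    exact hMN'.not_ge (hmax (show (t', N) ∈ K from ⟨⟨ht', hM0.trans hMN'.le, hNC⟩, hN.le⟩))
  have hfin := paneitz_le_at_min_curvature (lam := 0) (t₀ := t₀) (w := fun t => v t + M) ha0
    (fun t => (hv t).add_const M) hv₁ hv₂ hv₃ (fun t => by linarith [hpos t])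
    (by rw [zero_mul]; exact le_antisymm hg0 (hnonneg t₀))
    (fun t => by rw [zero_mul]; exact hnonneg t)
  have hKM : 0 ≤ a ^ 2 * (a + 2) ^ 2 * M := by positivity
  have := hQ t₀
  simp only [zero_mul, ne_eq, OfNat.ofNat_ne_zero, not_false_eq_true, zero_pow, mul_zero] at hfin
  linarith

/-- Lower bound for the scalar curvature of a periodic solution on the cylinder. -/
theorem cylinder_inequality {a T : ℝ} (ha : 1 / 2 ≤ a) (hT : 0 < T) {v v₁ v₂ v₃ v₄ : ℝ → ℝ}
    (hv : ∀ t, HasDerivAt v (v₁ t) t) (hv₁ : ∀ t, HasDerivAt v₁ (v₂ t) t)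
    (hv₂ : ∀ t, HasDerivAt v₂ (v₃ t) t) (hv₃ : ∀ t, HasDerivAt v₃ (v₄ t) t)
    (hpos : ∀ t, 0 < v t)
    (hp : Function.Periodic v T) (hp₁ : Function.Periodic v₁ T) (hp₂ : Function.Periodic v₂ T)
    (heq : ∀ t, v₄ t - (2 * a ^ 2 + 4 * a + 4) * v₂ t + a ^ 2 * (a + 2) ^ 2 * v t
      = v t ^ (1 + 4 / a)) (t : ℝ) :
    √(a * (a + 2) / ((a + 1) * (a + 3))) * v t ^ (2 + 2 / a)
      ≤ (a * (a + 1) * v t - v₂ t) * v t - v₁ t ^ 2 / a := by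
  have ha0 : 0 < a := by linarith
  have cv : Continuous v := continuous_iff_continuousAt.2 fun t => (hv t).continuousAt
  have cv₁ : Continuous v₁ := continuous_iff_continuousAt.2 fun t => (hv₁ t).continuousAt
  have cv₂ : Continuous v₂ := continuous_iff_continuousAt.2 fun t => (hv₂ t).continuousAt
  have hG := scalar_curvature_pos ha hT hv hv₁ hv₂ hv₃ hpos hp hp₁ hp₂
    (fun t => by rw [heq]; exact Real.rpow_pos_of_pos (hpos t) _)
  have hq : ∀ t, 0 < v t ^ (2 + 2 / a) := fun t => Real.rpow_pos_of_pos (hpos t) _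
  set J : ℝ → ℝ := fun t =>
    ((a * (a + 1) * v t - v₂ t) * v t - v₁ t ^ 2 / a) / v t ^ (2 + 2 / a) with hJ
  have cJ : Continuous J := by
    refine Continuous.div (by fun_prop) ?_ fun t => (hq t).ne'
    exact cv.rpow_const fun t => Or.inl (hpos t).ne'
  have hJp : Function.Periodic J T := fun t => by simp only [hJ, hp t, hp₁ t, hp₂ t]
  obtain ⟨t₀, -, hmin⟩ := (isCompact_Icc (a := 0) (b := T)).exists_isMinOn
    (Set.nonempty_Icc.2 hT.le) cJ.continuousOn
  have hmin' : ∀ t, J t₀ ≤ J t := by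
    intro t
    obtain ⟨t', ht', htt'⟩ := hJp.exists_mem_Ico₀ hT t
    rw [htt']
    exact hmin (Set.Ico_subset_Icc_self ht')
  have hJ0 : 0 < J t₀ := div_pos (hG t₀) (hq t₀)
  have hfin := paneitz_le_at_min_curvature (lam := J t₀) (t₀ := t₀) ha0 hv hv₁ hv₂ hv₃ hpos
    (div_mul_cancel₀ _ (hq t₀).ne').symm (fun t => (le_div_iff₀ (hq t)).1 (hmin' t))
  have hsplit : v t₀ ^ (1 + 4 / a) = (v t₀ ^ (2 / a)) ^ 2 * v t₀ := by
    rw [show 1 + 4 / a = 2 / a + 2 / a + 1 by ring, Real.rpow_add (hpos t₀),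
      Real.rpow_add (hpos t₀), Real.rpow_one]
    ring
  rw [heq, hsplit] at hfin
  have hP : 0 < (v t₀ ^ (2 / a)) ^ 2 * v t₀ :=
    mul_pos (pow_pos (Real.rpow_pos_of_pos (hpos t₀) _) _) (hpos t₀)
  have h1 : 1 ≤ (a + 1) * (a + 3) / (a * (a + 2)) * J t₀ ^ 2 := by
    refine le_of_mul_le_mul_right ?_ hP
    rw [one_mul]
    refine hfin.trans_eq ?_
    ring
  have hle : √(a * (a + 2) / ((a + 1) * (a + 3))) ≤ J t₀ := by
    rw [Real.sqrt_le_left hJ0.le, div_le_iff₀ (by positivity)]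
    rw [div_mul_eq_mul_div, le_div_iff₀ (by positivity)] at h1
    linarith
  exact (le_div_iff₀ (hq t)).1 (hle.trans (hmin' t))


/-- For `n ≥ 5` and a positive periodic `C⁴` solution `v` of
`v'''' + K₂ v'' + K₀ v = v^((n+4)/(n-4))` with `v ≤ L = (n³(n-4)/16)^((n-4)/8)`, the
radial function `u(r) = r^(-(n-4)/2) v(log r)` satisfies the pointwise inequality
`-Δu ≥ √(n(n-4)/(n²-4)) u^(n/(n-4)) + (2/(n-4)) u'²/u` on `(0,∞)`, where
`Δu(r) = u''(r) + ((n-1)/r) u'(r)`. -/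
theorem pointwise_inequality (n : ℕ) (hn : 5 ≤ n) (v : ℝ → ℝ)
    (hreg : ContDiff ℝ 4 v) (hpos : ∀ t : ℝ, 0 < v t)
    (hper : ∃ T : ℝ, 0 < T ∧ Function.Periodic v T)
    (hbound : ∀ t : ℝ, v t ≤ ((n:ℝ)^3 * ((n:ℝ) - 4) / 16) ^ (((n:ℝ) - 4) / 8))
    (heq : ∀ t : ℝ,
      iteratedDeriv 4 v t + (-(((n:ℝ)^2 - 4*(n:ℝ) + 8) / 2)) * iteratedDeriv 2 v t
        + ((n:ℝ)^2 * ((n:ℝ) - 4)^2 / 16) * v t = v t ^ (((n:ℝ) + 4) / ((n:ℝ) - 4)))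
    (u : ℝ → ℝ)
    (hu : ∀ r : ℝ, u r = r ^ (-(((n:ℝ) - 4) / 2)) * v (Real.log r)) :
    ∀ r : ℝ, 0 < r →
      Real.sqrt ((n:ℝ) * ((n:ℝ) - 4) / ((n:ℝ)^2 - 4)) * u r ^ ((n:ℝ) / ((n:ℝ) - 4))
        + (2 / ((n:ℝ) - 4)) * (deriv u r)^2 / u r
      ≤ -(iteratedDeriv 2 u r + (((n:ℝ) - 1) / r) * deriv u r) := by
  intro r hr
  obtain ⟨T, hT, hp⟩ := hper
  obtain ⟨a, ha⟩ : ∃ a : ℝ, (n : ℝ) = 2 * a + 4 := ⟨((n : ℝ) - 4) / 2, by ring⟩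
  have ha2 : 1 / 2 ≤ a := by
    have : (5 : ℝ) ≤ n := by exact_mod_cast hn
    linarith
  have ha0 : 0 < a := by linarith
  clear hbound
  rw [ha] at heq hu ⊢
  have hd : ∀ k : ℕ, k < 4 → ∀ t, HasDerivAt (iteratedDeriv k v) (iteratedDeriv (k + 1) v t) t := by
    intro k hk t
    rw [iteratedDeriv_succ]
    exact ((hreg.differentiable_iteratedDeriv k (by exact_mod_cast hk)) t).hasDerivAt
  have hpk : ∀ k : ℕ, Function.Periodic (iteratedDeriv k v) T := by
    intro k t
    have h := iteratedDeriv_comp_add_const k v T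
    rw [show (fun z => v (z + T)) = v from funext hp] at h
    exact (congrFun h t).symm
  have hv0 : ∀ t, HasDerivAt v (iteratedDeriv 1 v t) t := by
    simpa using hd 0 (by norm_num)
  have key := cylinder_inequality ha2 hT hv0 (hd 1 (by norm_num)) (hd 2 (by norm_num))
    (hd 3 (by norm_num)) hpos hp (hpk 1) (hpk 2) (fun t => by
      have h := heq t
      rw [show (2 * a + 4 + 4) / (2 * a + 4 - 4) = 1 + 4 / a by field_simp; ring] at h
      rw [← h]
      ring) (Real.log r)
  set w₁ := iteratedDeriv 1 v with hw₁
  set w₂ := iteratedDeriv 2 v with hw₂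
  have hu' : u = fun r => r ^ (-a) * v (Real.log r) := by
    funext r
    rw [hu, show -((2 * a + 4 - 4) / 2) = -a by ring]
  have hdu : ∀ x : ℝ, 0 < x → HasDerivAt u
      (x ^ (-a - 1) * (w₁ (Real.log x) - a * v (Real.log x))) x := by
    intro x hx
    rw [hu']
    refine HasDerivAt.congr_deriv ((Real.hasDerivAt_rpow_const (p := -a) (Or.inl hx.ne')).mul
      ((hv0 (Real.log x)).comp x (Real.hasDerivAt_log hx.ne'))) ?_
    have : x ^ (-a) = x ^ (-a - 1) * x := by
      rw [← Real.rpow_add_one hx.ne']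
      ring_nf
    rw [this]
    field_simp
    ring
  have hdu2 : HasDerivAt (deriv u) (r ^ (-a - 2) * (w₂ (Real.log r)
      - (2 * a + 1) * w₁ (Real.log r) + a * (a + 1) * v (Real.log r))) r := by
    have hev : deriv u =ᶠ[nhds r]
        fun x => x ^ (-a - 1) * (w₁ (Real.log x) - a * v (Real.log x)) := by
      filter_upwards [lt_mem_nhds hr] with x hx
      exact (hdu x hx).deriv
    refine HasDerivAt.congr_of_eventuallyEq ?_ hev
    have hl := Real.hasDerivAt_log hr.ne'
    refine HasDerivAt.congr_deriv ((Real.hasDerivAt_rpow_const (p := -a - 1) (Or.inl hr.ne')).mul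
      (((hd 1 (by norm_num) (Real.log r)).comp r hl).sub
        (((hv0 (Real.log r)).comp r hl).const_mul a))) ?_
    have : r ^ (-a - 1) = r ^ (-a - 2) * r := by
      rw [← Real.rpow_add_one hr.ne']
      ring_nf
    rw [show -a - 1 - 1 = -a - 2 by ring, this]
    field_simp
    ring
  have h2 : iteratedDeriv 2 u r = deriv (deriv u) r := by
    rw [iteratedDeriv_succ, iteratedDeriv_one]
  rw [h2, hdu2.deriv, (hdu r hr).deriv, hu']
  set x := v (Real.log r)
  set y := w₁ (Real.log r)
  set z := w₂ (Real.log r)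
  have hx : 0 < x := hpos _
  set R := r ^ (-a - 2) with hR
  have hR0 : 0 < R := Real.rpow_pos_of_pos hr _
  have r1 : r ^ (-a - 1) = R * r := by
    rw [hR, ← Real.rpow_add_one hr.ne']
    ring_nf
  have r2 : r ^ (-a) = R * r ^ 2 := by
    rw [hR, ← Real.rpow_add_natCast hr.ne']
    norm_num
  have e : (2 * a + 4) / (2 * a + 4 - 4) = 1 + 2 / a := by
    field_simp
    ring
  have hpow : (r ^ (-a) * x) ^ (1 + 2 / a) = R * x ^ (1 + 2 / a) := by
    rw [Real.mul_rpow (Real.rpow_nonneg hr.le _) hx.le, ← Real.rpow_mul hr.le, hR]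
    congr 2
    field_simp
    ring
  have hxx : x ^ (2 + 2 / a) = x ^ (1 + 2 / a) * x := by
    rw [← Real.rpow_add_one hx.ne']
    ring_nf
  have hc : (2 * a + 4) * (2 * a + 4 - 4) / ((2 * a + 4) ^ 2 - 4)
      = a * (a + 2) / ((a + 1) * (a + 3)) := by
    rw [show (2 * a + 4) ^ 2 - 4 = 4 * ((a + 1) * (a + 3)) by ring]
    field_simp
    ring
  rw [e, hc]
  dsimp only
  rw [hpow, r1, r2]
  rw [hxx] at key
  set c := √(a * (a + 2) / ((a + 1) * (a + 3)))
  set P := x ^ (1 + 2 / a)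
  have key' : c * P ≤ a * (a + 1) * x - z - y ^ 2 / (a * x) := by
    refine le_of_mul_le_mul_right ?_ hx
    have : (a * (a + 1) * x - z - y ^ 2 / (a * x)) * x
        = (a * (a + 1) * x - z) * x - y ^ 2 / a := by
      field_simp
    rw [this, mul_assoc]
    exact key
  have hrew : -(R * (z - (2 * a + 1) * y + a * (a + 1) * x)
        + (2 * a + 4 - 1) / r * (R * r * (y - a * x)))
      - (c * (R * P) + 2 / (2 * a + 4 - 4) * (R * r * (y - a * x)) ^ 2 / (R * r ^ 2 * x))
      = R * (a * (a + 1) * x - z - y ^ 2 / (a * x) - c * P) := by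
    rw [show 2 * a + 4 - 4 = 2 * a by ring]
    field_simp
    ring
  have := mul_nonneg hR0.le (sub_nonneg.2 key')
  linarith
end
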